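/- Let D ⊂ R^d be a bounded Lipschitz domain, n ∈ L^∞(D) with Im(n) > 0 on a set of positive measure. Then there are no real transmission eigenvalues: if k > 0 and (u,v) solve the transmission eigenvalue problem Δu + k²nu = 0, Δv + k²v = 0 in D with u = v and ∂_ν u = ∂_ν v on ∂D (u, v ∈ H²(D)), then u ≡ 0 and v ≡ 0 in D. -/

import Mathlib

open MeasureTheory

/-- The Laplacian of a complex-valued function on `ℝ^d`. -/
noncomputable def lapC (d : ℕ) (u : (Fin d → ℝ) → ℂ) (x : Fin d → ℝ) : ℂ :=
  ∑ i, fderiv ℝ (fun y => fderiv ℝ u y (Pi.single i 1)) x (Pi.single i 1)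

open Set Filter Topology

/-- partial derivative -/
noncomputable def pd {d : ℕ} (i : Fin d) (f : (Fin d → ℝ) → ℝ) (x : Fin d → ℝ) : ℝ :=
  fderiv ℝ f x (Pi.single i 1)

/-- squared Euclidean norm -/
def nsq {d : ℕ} (x : Fin d → ℝ) : ℝ := ∑ i, x i ^ 2

/-- weight -/
noncomputable def wt {d : ℕ} (r : ℝ) (x : Fin d → ℝ) : ℝ := max (r ^ 2 - nsq x) 0

lemma hasDerivAt_maxpow (m : ℕ) (s : ℝ) :
    HasDerivAt (fun t : ℝ => max t 0 ^ (m + 2)) ((m + 2 : ℕ) * max s 0 ^ (m + 1)) s := by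
  rcases lt_trichotomy s 0 with h | h | h
  · have : (fun t : ℝ => max t 0 ^ (m + 2)) =ᶠ[𝓝 s] fun _ => 0 := by
      filter_upwards [Iio_mem_nhds h] with t ht
      rw [max_eq_right (le_of_lt ht)]; simp
    rw [max_eq_right h.le]
    simpa using (hasDerivAt_const s (0 : ℝ)).congr_of_eventuallyEq this
  · subst h
    simp only [max_self, ne_eq, Nat.add_eq_zero_iff, one_ne_zero, and_false, not_false_eq_true,
      zero_pow, mul_zero]
    rw [hasDerivAt_iff_isLittleO_nhds_zero]
    simp only [zero_add, max_self, ne_eq, Nat.add_eq_zero_iff, OfNat.ofNat_ne_zero, and_false,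
      not_false_eq_true, zero_pow, sub_zero, smul_zero]
    have h1 : (fun h : ℝ => max h 0 ^ (m + 2)) =O[𝓝 0] fun h : ℝ => h ^ (m + 2) := by
      refine Asymptotics.IsBigO.of_bound 1 (Eventually.of_forall fun h => ?_)
      simp only [norm_pow, one_mul]
      gcongr
      rw [Real.norm_eq_abs, Real.norm_eq_abs, abs_of_nonneg (le_max_right _ _)]
      exact max_le (le_abs_self _) (abs_nonneg _)
    refine h1.trans_isLittleO ?_
    have := Asymptotics.isLittleO_pow_id (𝕜 := ℝ) (n := m + 2) (by omega)
    simpa using this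
  · have : (fun t : ℝ => max t 0 ^ (m + 2)) =ᶠ[𝓝 s] fun t => t ^ (m + 2) := by
      filter_upwards [Ioi_mem_nhds h] with t ht
      rw [max_eq_left (le_of_lt ht)]
    rw [max_eq_left h.le]
    simpa using (hasDerivAt_pow (m + 2) s).congr_of_eventuallyEq this

lemma continuous_nsq {d : ℕ} : Continuous (nsq : (Fin d → ℝ) → ℝ) := by
  unfold nsq; fun_prop

lemma continuous_wt {d : ℕ} (r : ℝ) : Continuous (wt r : (Fin d → ℝ) → ℝ) := by
  unfold wt; exact (continuous_const.sub continuous_nsq).max continuous_const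

lemma wt_nonneg {d : ℕ} (r : ℝ) (x : Fin d → ℝ) : 0 ≤ wt r x := le_max_right _ _

lemma nsq_nonneg {d : ℕ} (x : Fin d → ℝ) : 0 ≤ nsq x := Finset.sum_nonneg fun i _ => sq_nonneg _

lemma wt_le {d : ℕ} (r : ℝ) (x : Fin d → ℝ) : wt r x ≤ r ^ 2 :=
  max_le (by linarith [nsq_nonneg x]) (sq_nonneg r)

lemma wt_ne_zero {d : ℕ} {r : ℝ} {x : Fin d → ℝ} (h : wt r x ≠ 0) : nsq x < r ^ 2 := by
  by_contra h'
  exact h (max_eq_right (by linarith))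

lemma norm_le_of_sq {d : ℕ} {r : ℝ} (hr : 0 ≤ r) {x : Fin d → ℝ} (h : nsq x ≤ r ^ 2) : ‖x‖ ≤ r := by
  rw [pi_norm_le_iff_of_nonneg hr]
  intro i
  rw [Real.norm_eq_abs]
  apply abs_le_of_sq_le_sq _ hr
  refine le_trans ?_ h
  exact Finset.single_le_sum (f := fun i => x i ^ 2) (fun i _ => sq_nonneg _) (Finset.mem_univ i)

lemma wt_supp {d : ℕ} (r : ℝ) (x : Fin d → ℝ) (hx : x ∉ Metric.closedBall 0 |r|) : wt r x = 0 := by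
  by_contra h
  apply hx
  have := wt_ne_zero h
  rw [mem_closedBall_zero_iff]
  exact norm_le_of_sq (abs_nonneg r) (by rw [sq_abs]; exact this.le)

lemma hcs_wt {d : ℕ} (r : ℝ) (m : ℕ) (g : (Fin d → ℝ) → ℝ) :
    HasCompactSupport (fun x => g x * wt r x ^ (m + 1)) := by
  refine HasCompactSupport.intro (isCompact_closedBall (0 : Fin d → ℝ) |r|) fun x hx => ?_
  rw [wt_supp r x hx]; simp

lemma integrable_wt {d : ℕ} (r : ℝ) (m : ℕ) {g : (Fin d → ℝ) → ℝ} (hg : Continuous g) :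
    Integrable (fun x => g x * wt r x ^ (m + 1)) :=
  (hg.mul ((continuous_wt r).pow _)).integrable_of_hasCompactSupport (hcs_wt r m g)

lemma hasFDerivAt_nsq {d : ℕ} (x : Fin d → ℝ) :
    HasFDerivAt nsq (∑ i, (2 * x i) • (ContinuousLinearMap.proj (R := ℝ) (φ := fun _ : Fin d => ℝ) i)) x := by
  unfold nsq
  apply HasFDerivAt.fun_sum
  intro i _
  have := (hasFDerivAt_apply (𝕜 := ℝ) (F' := fun _ : Fin d => ℝ) i x).pow 2
  simpa using this

lemma hasFDerivAt_wt {d : ℕ} (r : ℝ) (m : ℕ) (x : Fin d → ℝ) :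
    HasFDerivAt (fun x => wt r x ^ (m + 2))
      (((m + 2 : ℕ) * wt r x ^ (m + 1)) • (-(∑ i, (2 * x i) •
        (ContinuousLinearMap.proj (R := ℝ) (φ := fun _ : Fin d => ℝ) i)))) x := by
  have h1 := hasDerivAt_maxpow m (r ^ 2 - nsq x)
  have h2 : HasFDerivAt (fun x : Fin d → ℝ => r ^ 2 - nsq x) _ x := (hasFDerivAt_nsq x).const_sub (r ^ 2)
  exact h1.comp_hasFDerivAt x h2

lemma pd_wt {d : ℕ} (r : ℝ) (m : ℕ) (i : Fin d) (x : Fin d → ℝ) :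
    pd i (fun x => wt r x ^ (m + 2)) x = - (2 * (m + 2 : ℕ)) * (x i * wt r x ^ (m + 1)) := by
  unfold pd
  rw [(hasFDerivAt_wt r m x).fderiv]
  simp [Pi.single_apply]
  ring

/-- Integration by parts against the weight. -/
lemma ibp_wt {d : ℕ} (r : ℝ) (m : ℕ) (i : Fin d) {g : (Fin d → ℝ) → ℝ} (hg : ContDiff ℝ 1 g) :
    ∫ x, pd i g x * wt r x ^ (m + 2) =
      (2 * (m + 2 : ℕ)) * ∫ x, (g x * x i) * wt r x ^ (m + 1) := by
  have hc : Continuous (pd i g) := (hg.continuous_fderiv one_ne_zero).clm_apply continuous_const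
  have key := integral_mul_fderiv_eq_neg_fderiv_mul_of_integrable (μ := (volume : Measure (Fin d → ℝ)))
    (f := g) (g := fun x => wt r x ^ (m + 2)) (v := Pi.single i 1)
    (integrable_wt r (m + 1) hc) ?_ (integrable_wt r (m + 1) hg.continuous)
    (fun x _ => hg.differentiable one_ne_zero x)
    (fun x _ => (hasFDerivAt_wt r m x).differentiableAt)
  · have h2 : ∀ x, g x * fderiv ℝ (fun x => wt r x ^ (m + 2)) x (Pi.single i 1)
        = - (2 * (m + 2 : ℕ)) * ((g x * x i) * wt r x ^ (m + 1)) := fun x => by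
      have := pd_wt r m i x
      unfold pd at this
      rw [this]; ring
    simp_rw [h2] at key
    rw [integral_const_mul] at key
    unfold pd
    linarith
  · have h2 : ∀ x, g x * fderiv ℝ (fun x => wt r x ^ (m + 2)) x (Pi.single i 1)
        = ((- (2 * (m + 2 : ℕ))) * (g x * x i)) * wt r x ^ (m + 1) := fun x => by
      have := pd_wt r m i x
      unfold pd at this
      rw [this]; ring
    simp_rw [h2]
    exact integrable_wt r m (continuous_const.mul (hg.continuous.mul (continuous_apply i)))

/-- Differentiating weighted integrals in the radius. -/
lemma hasDerivAt_wt {d : ℕ} (r : ℝ) (m : ℕ) {g : (Fin d → ℝ) → ℝ} (hg : Continuous g) :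
    HasDerivAt (fun r => ∫ x, g x * wt r x ^ (m + 2))
      ((2 * (m + 2 : ℕ)) * r * ∫ x, g x * wt r x ^ (m + 1)) r := by
  have hd : ∀ (x : Fin d → ℝ) (ρ : ℝ), HasDerivAt (fun ρ => g x * wt ρ x ^ (m + 2))
      ((2 * (m + 2 : ℕ)) * ρ * (g x * wt ρ x ^ (m + 1))) ρ := by
    intro x ρ
    have h1 := hasDerivAt_maxpow m (ρ ^ 2 - nsq x)
    have h2 : HasDerivAt (fun ρ : ℝ => ρ ^ 2 - nsq x) (2 * ρ) ρ := by
      simpa using (hasDerivAt_pow 2 ρ).sub_const (nsq x)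
    have h3 := (h1.comp ρ h2).const_mul (g x)
    have e : (2 * (m + 2 : ℕ)) * ρ * (g x * wt ρ x ^ (m + 1))
        = g x * ((m + 2 : ℕ) * max (ρ ^ 2 - nsq x) 0 ^ (m + 1) * (2 * ρ)) := by
      unfold wt; ring
    rw [e]
    exact h3
  have := (hasDerivAt_integral_of_dominated_loc_of_deriv_le (μ := (volume : Measure (Fin d → ℝ)))
    (F := fun ρ x => g x * wt ρ x ^ (m + 2))
    (F' := fun ρ x => (2 * (m + 2 : ℕ)) * ρ * (g x * wt ρ x ^ (m + 1))) (x₀ := r)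
    (bound := fun x => (2 * (m + 2 : ℕ)) * (|r| + 1) * (|g x| * wt (|r| + 1) x ^ (m + 1)))
    (Metric.ball_mem_nhds r one_pos) ?_ ?_ ?_ ?_ ?_ ?_).2
  · rw [integral_const_mul] at this
    exact this
  · exact Eventually.of_forall fun ρ => (integrable_wt ρ (m + 1) hg).aestronglyMeasurable
  · exact integrable_wt r (m + 1) hg
  · exact ((integrable_wt r m hg).const_mul _).aestronglyMeasurable
  · refine Eventually.of_forall fun x ρ hρ => ?_
    have hρ' : |ρ| ≤ |r| + 1 := by
      rw [Metric.mem_ball, Real.dist_eq] at hρ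
      have := abs_sub_abs_le_abs_sub ρ r
      linarith
    have hw : wt ρ x ≤ wt (|r| + 1) x := by
      unfold wt
      apply max_le_max _ le_rfl
      have : ρ ^ 2 ≤ (|r| + 1) ^ 2 := by
        rw [← sq_abs ρ]; gcongr
      linarith
    have h0 := wt_nonneg ρ x
    simp only [norm_mul, Real.norm_eq_abs, norm_pow, abs_of_nonneg h0, Nat.abs_ofNat, Nat.abs_cast]
    gcongr
  · exact (integrable_wt (|r| + 1) m hg.abs).const_mul _
  · exact Eventually.of_forall fun x ρ _ => hd x ρ

/-- real Laplacian -/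
noncomputable def lapR {d : ℕ} (u : (Fin d → ℝ) → ℝ) (x : Fin d → ℝ) : ℝ := ∑ i, pd i (pd i u) x

/-- squared gradient -/
noncomputable def gr2 {d : ℕ} (u : (Fin d → ℝ) → ℝ) (x : Fin d → ℝ) : ℝ := ∑ i, pd i u x ^ 2

/-- radial derivative -/
noncomputable def rad {d : ℕ} (u : (Fin d → ℝ) → ℝ) (x : Fin d → ℝ) : ℝ := ∑ i, x i * pd i u x

lemma pd_mul {d : ℕ} (i : Fin d) {f g : (Fin d → ℝ) → ℝ} {x : Fin d → ℝ}
    (hf : DifferentiableAt ℝ f x) (hg : DifferentiableAt ℝ g x) :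
    pd i (fun x => f x * g x) x = f x * pd i g x + pd i f x * g x := by
  unfold pd
  rw [fderiv_fun_mul hf hg]
  simp; ring

lemma pd_coord {d : ℕ} (i j : Fin d) (x : Fin d → ℝ) :
    pd i (fun x => x j) x = if i = j then 1 else 0 := by
  unfold pd
  rw [(hasFDerivAt_apply (𝕜 := ℝ) (F' := fun _ : Fin d => ℝ) j x).fderiv]
  simp [Pi.single_apply, eq_comm]

lemma pd_sum {d : ℕ} (i : Fin d) {f : Fin d → (Fin d → ℝ) → ℝ} {x : Fin d → ℝ}
    (hf : ∀ j, DifferentiableAt ℝ (f j) x) :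
    pd i (fun x => ∑ j, f j x) x = ∑ j, pd i (f j) x := by
  unfold pd
  rw [fderiv_fun_sum (fun j _ => hf j)]
  simp

lemma pd_sq {d : ℕ} (i : Fin d) {f : (Fin d → ℝ) → ℝ} {x : Fin d → ℝ}
    (hf : DifferentiableAt ℝ f x) : pd i (fun x => f x ^ 2) x = 2 * f x * pd i f x := by
  have : (fun x => f x ^ 2) = fun x => f x * f x := by ext; ring
  rw [this, pd_mul i hf hf]; ring

lemma contDiff_pd {d : ℕ} (i : Fin d) {u : (Fin d → ℝ) → ℝ} (hu : ContDiff ℝ 2 u) :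
    ContDiff ℝ 1 (pd i u) := by
  unfold pd
  exact (hu.fderiv_right (m := 1) (by norm_num)).clm_apply contDiff_const

lemma continuous_pd {d : ℕ} (i : Fin d) {u : (Fin d → ℝ) → ℝ} (hu : ContDiff ℝ 1 u) :
    Continuous (pd i u) := (hu.continuous_fderiv one_ne_zero).clm_apply continuous_const

lemma continuous_lapR {d : ℕ} {u : (Fin d → ℝ) → ℝ} (hu : ContDiff ℝ 2 u) :
    Continuous (lapR u) :=
  continuous_finsetSum _ fun i _ => continuous_pd i (contDiff_pd i hu)

lemma contDiff_gr2 {d : ℕ} {u : (Fin d → ℝ) → ℝ} (hu : ContDiff ℝ 2 u) : ContDiff ℝ 1 (gr2 u) :=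
  ContDiff.sum fun i _ => (contDiff_pd i hu).pow 2

lemma contDiff_rad {d : ℕ} {u : (Fin d → ℝ) → ℝ} (hu : ContDiff ℝ 2 u) : ContDiff ℝ 1 (rad u) :=
  ContDiff.sum fun i _ => (contDiff_apply ℝ ℝ i).mul (contDiff_pd i hu)

lemma pd_comm {d : ℕ} (i j : Fin d) {u : (Fin d → ℝ) → ℝ} {x : Fin d → ℝ}
    (hu : ContDiffAt ℝ 2 u x) : pd i (pd j u) x = pd j (pd i u) x := by
  have hd : DifferentiableAt ℝ (fderiv ℝ u) x :=
    (hu.fderiv_right (m := 1) (by norm_num)).differentiableAt one_ne_zero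
  have e : ∀ a b : Fin d, pd a (pd b u) x = fderiv ℝ (fderiv ℝ u) x (Pi.single a 1) (Pi.single b 1) := by
    intro a b
    unfold pd
    have := (hd.hasFDerivAt.clm_apply (hasFDerivAt_const (Pi.single b 1 : Fin d → ℝ) x)).fderiv
    rw [this]
    simp
  rw [e, e]
  have := hu.isSymmSndFDerivAt (by simp)
  exact this _ _

section ids

variable {d : ℕ} {u : (Fin d → ℝ) → ℝ}

/-- (a) -/
lemma id_a (hu : ContDiff ℝ 2 u) (r : ℝ) :
    4 * r ^ 2 * ∫ x, u x ^ 2 * wt r x ^ 1 =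
      (4 + d) * (∫ x, u x ^ 2 * wt r x ^ 2) + 2 * ∫ x, (u x * rad u x) * wt r x ^ 2 := by
  have hu1 : ContDiff ℝ 1 u := hu.of_le (by norm_num)
  have hc := hu.continuous
  have h1 : ∀ i : Fin d, ∫ x, (u x ^ 2 + 2 * u x * (x i * pd i u x)) * wt r x ^ 2 =
      4 * ∫ x, (x i ^ 2 * u x ^ 2) * wt r x ^ 1 := by
    intro i
    have hci := continuous_pd i hu1
    have := ibp_wt r 0 i (g := fun x => x i * u x ^ 2) ((contDiff_apply ℝ ℝ i).mul (hu1.pow 2))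
    have e : ∀ x : Fin d → ℝ, pd i (fun x => x i * u x ^ 2) x = u x ^ 2 + 2 * u x * (x i * pd i u x) := by
      intro x
      have hux : DifferentiableAt ℝ u x := hu1.differentiable one_ne_zero x
      rw [pd_mul i (differentiableAt_apply i x) (hux.fun_pow 2), pd_sq i hux, pd_coord]
      simp; ring
    simp_rw [e] at this
    rw [this]
    congr 1
    · norm_num
    · congr 1; ext x; ring
  have h2 := Finset.sum_congr (rfl : (Finset.univ : Finset (Fin d)) = Finset.univ) (fun i _ => h1 i)
  rw [← Finset.mul_sum, ← integral_finsetSum, ← integral_finsetSum] at h2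
  · have e1 : ∀ x : Fin d → ℝ, ∑ i, (u x ^ 2 + 2 * u x * (x i * pd i u x)) * wt r x ^ 2
        = d * (u x ^ 2 * wt r x ^ 2) + 2 * ((u x * rad u x) * wt r x ^ 2) := by
      intro x
      unfold rad
      rw [← Finset.sum_mul, Finset.sum_add_distrib, ← Finset.mul_sum]
      simp; ring
    have e2 : ∀ x : Fin d → ℝ, ∑ i, (x i ^ 2 * u x ^ 2) * wt r x ^ 1
        = r ^ 2 * (u x ^ 2 * wt r x ^ 1) - u x ^ 2 * wt r x ^ 2 := by
      intro x
      rw [← Finset.sum_mul, ← Finset.sum_mul]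
      change nsq x * _ * _ = _
      by_cases hw : wt r x = 0
      · rw [hw]; simp
      · have : wt r x = r ^ 2 - nsq x := max_eq_left (by linarith [wt_ne_zero hw])
        rw [this]; ring
    simp_rw [e1, e2] at h2
    rw [integral_add, integral_sub] at h2
    · simp_rw [integral_const_mul] at h2
      linarith
    · exact (integrable_wt r 0 (hc.pow 2)).const_mul _
    · exact (integrable_wt r 1 (hc.pow 2))
    · exact (integrable_wt r 1 (hc.pow 2)).const_mul _
    · exact (integrable_wt r 1 (hc.mul (contDiff_rad hu).continuous)).const_mul _
  · intro i _
    exact integrable_wt r 0 (by fun_prop)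
  · intro i _
    have hci := continuous_pd i hu1
    exact integrable_wt r 1 (by fun_prop)

/-- (b) -/
lemma id_b (hu : ContDiff ℝ 2 u) (r : ℝ) :
    ∫ x, (gr2 u x + u x * lapR u x) * wt r x ^ 3 = 6 * ∫ x, (u x * rad u x) * wt r x ^ 2 := by
  have hu1 : ContDiff ℝ 1 u := hu.of_le (by norm_num)
  have hc := hu.continuous
  have h1 : ∀ i : Fin d, ∫ x, (pd i u x ^ 2 + u x * pd i (pd i u) x) * wt r x ^ 3 =
      6 * ∫ x, (u x * (x i * pd i u x)) * wt r x ^ 2 := by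
    intro i
    have := ibp_wt r 1 i (g := fun x => u x * pd i u x) (hu1.mul (contDiff_pd i hu))
    have e : ∀ x : Fin d → ℝ, pd i (fun x => u x * pd i u x) x = pd i u x ^ 2 + u x * pd i (pd i u) x := by
      intro x
      rw [pd_mul i (hu1.differentiable one_ne_zero x) ((contDiff_pd i hu).differentiable one_ne_zero x)]
      ring
    simp_rw [e] at this
    rw [this]
    congr 1
    · norm_num
    · congr 1; ext x; ring
  have h2 := Finset.sum_congr (rfl : (Finset.univ : Finset (Fin d)) = Finset.univ) (fun i _ => h1 i)
  rw [← Finset.mul_sum, ← integral_finsetSum, ← integral_finsetSum] at h2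
  · simp_rw [← Finset.sum_mul, Finset.sum_add_distrib, ← Finset.mul_sum] at h2
    exact h2
  · intro i _
    have hci := continuous_pd i hu1
    exact integrable_wt r 1 (by fun_prop)
  · intro i _
    have hci := continuous_pd i hu1
    have hcii := continuous_pd i (contDiff_pd i hu)
    exact integrable_wt r 2 (by fun_prop)

/-- mixed second-order term -/
noncomputable def mixT {d : ℕ} (u : (Fin d → ℝ) → ℝ) (x : Fin d → ℝ) : ℝ :=
  ∑ i, ∑ j, x i * pd j u x * pd i (pd j u) x

lemma continuous_mixT (hu : ContDiff ℝ 2 u) : Continuous (mixT u) := by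
  refine continuous_finsetSum _ fun i _ => continuous_finsetSum _ fun j _ => ?_
  exact ((continuous_apply i).mul (contDiff_pd j hu).continuous).mul (continuous_pd i (contDiff_pd j hu))

/-- (c) -/
lemma id_c (hu : ContDiff ℝ 2 u) (r : ℝ) :
    6 * r ^ 2 * ∫ x, gr2 u x * wt r x ^ 2 =
      (6 + d) * (∫ x, gr2 u x * wt r x ^ 3) + 2 * ∫ x, mixT u x * wt r x ^ 3 := by
  have hc := (contDiff_gr2 hu).continuous
  have eg : ∀ (i : Fin d) (x : Fin d → ℝ), pd i (gr2 u) x = ∑ j, 2 * pd j u x * pd i (pd j u) x := by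
    intro i x
    have hd : ∀ j, DifferentiableAt ℝ (pd j u) x := fun j => (contDiff_pd j hu).differentiable one_ne_zero x
    unfold gr2
    rw [pd_sum i (f := fun j x => pd j u x ^ 2) (fun j => (hd j).fun_pow 2)]
    exact Finset.sum_congr rfl fun j _ => pd_sq i (hd j)
  have hcg : ∀ i, Continuous (pd i (gr2 u)) := fun i => continuous_pd i (contDiff_gr2 hu)
  have h1 : ∀ i : Fin d, ∫ x, (gr2 u x + x i * pd i (gr2 u) x) * wt r x ^ 3 =
      6 * ∫ x, (x i ^ 2 * gr2 u x) * wt r x ^ 2 := by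
    intro i
    have := ibp_wt r 1 i (g := fun x => x i * gr2 u x) ((contDiff_apply ℝ ℝ i).mul (contDiff_gr2 hu))
    have e : ∀ x : Fin d → ℝ, pd i (fun x => x i * gr2 u x) x = gr2 u x + x i * pd i (gr2 u) x := by
      intro x
      rw [pd_mul i (differentiableAt_apply i x) ((contDiff_gr2 hu).differentiable one_ne_zero x), pd_coord]
      simp; ring
    simp_rw [e] at this
    rw [this]
    congr 1
    · norm_num
    · congr 1; ext x; ring
  have h2 := Finset.sum_congr (rfl : (Finset.univ : Finset (Fin d)) = Finset.univ) (fun i _ => h1 i)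
  rw [← Finset.mul_sum, ← integral_finsetSum, ← integral_finsetSum] at h2
  · have e1 : ∀ x : Fin d → ℝ, ∑ i, (gr2 u x + x i * pd i (gr2 u) x) * wt r x ^ 3
        = d * (gr2 u x * wt r x ^ 3) + 2 * (mixT u x * wt r x ^ 3) := by
      intro x
      rw [← Finset.sum_mul, Finset.sum_add_distrib]
      have : ∑ i, x i * pd i (gr2 u) x = 2 * mixT u x := by
        unfold mixT
        simp_rw [eg, Finset.mul_sum]
        refine Finset.sum_congr rfl fun i _ => Finset.sum_congr rfl fun j _ => ?_
        ring
      rw [this]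
      simp; ring
    have e2 : ∀ x : Fin d → ℝ, ∑ i, (x i ^ 2 * gr2 u x) * wt r x ^ 2
        = r ^ 2 * (gr2 u x * wt r x ^ 2) - gr2 u x * wt r x ^ 3 := by
      intro x
      rw [← Finset.sum_mul, ← Finset.sum_mul]
      change nsq x * _ * _ = _
      by_cases hw : wt r x = 0
      · rw [hw]; simp
      · have : wt r x = r ^ 2 - nsq x := max_eq_left (by linarith [wt_ne_zero hw])
        rw [this]; ring
    simp_rw [e1, e2] at h2
    rw [integral_add, integral_sub] at h2
    · simp_rw [integral_const_mul] at h2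
      linarith
    · exact (integrable_wt r 1 hc).const_mul _
    · exact (integrable_wt r 2 hc)
    · exact (integrable_wt r 2 hc).const_mul _
    · exact (integrable_wt r 2 (continuous_mixT hu)).const_mul _
  · intro i _
    exact integrable_wt r 1 (by fun_prop)
  · intro i _
    have hci := hcg i
    exact integrable_wt r 2 (by fun_prop)

/-- (d) -/
lemma id_d (hu : ContDiff ℝ 2 u) (r : ℝ) :
    (∫ x, gr2 u x * wt r x ^ 3) + (∫ x, mixT u x * wt r x ^ 3) +
      (∫ x, (rad u x * lapR u x) * wt r x ^ 3) = 6 * ∫ x, rad u x ^ 2 * wt r x ^ 2 := by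
  have hcr := (contDiff_rad hu).continuous
  have er : ∀ (i : Fin d) (x : Fin d → ℝ), pd i (rad u) x = pd i u x + ∑ j, x j * pd i (pd j u) x := by
    intro i x
    have hd : ∀ j, DifferentiableAt ℝ (pd j u) x := fun j => (contDiff_pd j hu).differentiable one_ne_zero x
    unfold rad
    rw [pd_sum i (fun j => (differentiableAt_apply j x).fun_mul (hd j))]
    simp_rw [fun j => pd_mul i (differentiableAt_apply j x) (hd j), pd_coord, Finset.sum_add_distrib]
    simp; ring
  have h1 : ∀ i : Fin d, ∫ x, (rad u x * pd i (pd i u) x + pd i (rad u) x * pd i u x) * wt r x ^ 3 =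
      6 * ∫ x, (rad u x * (x i * pd i u x)) * wt r x ^ 2 := by
    intro i
    have := ibp_wt r 1 i (g := fun x => rad u x * pd i u x) ((contDiff_rad hu).mul (contDiff_pd i hu))
    have e : ∀ x : Fin d → ℝ, pd i (fun x => rad u x * pd i u x) x
        = rad u x * pd i (pd i u) x + pd i (rad u) x * pd i u x := by
      intro x
      rw [pd_mul i ((contDiff_rad hu).differentiable one_ne_zero x)
        ((contDiff_pd i hu).differentiable one_ne_zero x)]
    simp_rw [e] at this
    rw [this]
    congr 1
    · norm_num
    · congr 1; ext x; ring
  have h2 := Finset.sum_congr (rfl : (Finset.univ : Finset (Fin d)) = Finset.univ) (fun i _ => h1 i)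
  rw [← Finset.mul_sum, ← integral_finsetSum, ← integral_finsetSum] at h2
  · have e1 : ∀ x : Fin d → ℝ, ∑ i, (rad u x * pd i (pd i u) x + pd i (rad u) x * pd i u x) * wt r x ^ 3
        = gr2 u x * wt r x ^ 3 + mixT u x * wt r x ^ 3 + (rad u x * lapR u x) * wt r x ^ 3 := by
      intro x
      rw [← Finset.sum_mul, Finset.sum_add_distrib, ← Finset.mul_sum]
      have : ∑ i, pd i (rad u) x * pd i u x = gr2 u x + mixT u x := by
        unfold mixT gr2
        rw [Finset.sum_comm (f := fun i j => x i * pd j u x * pd i (pd j u) x), ← Finset.sum_add_distrib]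
        refine Finset.sum_congr rfl fun i _ => ?_
        rw [er, add_mul, Finset.sum_mul]
        congr 1
        · ring
        · refine Finset.sum_congr rfl fun j _ => ?_
          rw [pd_comm i j hu.contDiffAt]; ring
      rw [this]
      unfold lapR; ring
    have e2 : ∀ x : Fin d → ℝ, ∑ i, (rad u x * (x i * pd i u x)) * wt r x ^ 2
        = rad u x ^ 2 * wt r x ^ 2 := by
      intro x
      rw [← Finset.sum_mul, ← Finset.mul_sum]
      change rad u x * rad u x * _ = _
      ring
    simp_rw [e1, e2] at h2
    rw [integral_add, integral_add] at h2
    · linarith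
    · exact (integrable_wt r 2 (contDiff_gr2 hu).continuous)
    · exact (integrable_wt r 2 (continuous_mixT hu))
    · exact (integrable_wt r 2 (contDiff_gr2 hu).continuous).add (integrable_wt r 2 (continuous_mixT hu))
    · exact (integrable_wt r 2 (hcr.mul (continuous_lapR hu)))
  · intro i _
    have hci := (contDiff_pd i hu).continuous
    exact integrable_wt r 1 (by fun_prop)
  · intro i _
    have hci := (contDiff_pd i hu).continuous
    have hcii := continuous_pd i (contDiff_pd i hu)
    have hcr' := continuous_pd i (contDiff_rad hu)
    exact integrable_wt r 2 (by fun_prop)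

end ids

lemma rad_sq_le {d : ℕ} (u : (Fin d → ℝ) → ℝ) (x : Fin d → ℝ) : rad u x ^ 2 ≤ nsq x * gr2 u x :=
  Finset.sum_mul_sq_le_sq_mul_sq _ _ _

lemma gr2_nonneg {d : ℕ} (u : (Fin d → ℝ) → ℝ) (x : Fin d → ℝ) : 0 ≤ gr2 u x :=
  Finset.sum_nonneg fun _ _ => sq_nonneg _

lemma freq_alg {d : ℕ} {M r H1 J A A2 T P Q B3 B2 h i : ℝ} (hM : 0 ≤ M) (hr : 0 < r) (hr1 : r ≤ 1)
    (hHr : 0 < h)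
    (ha : 4 * r ^ 2 * H1 = (4 + d) * h + 2 * J) (hb : i = 6 * J)
    (hcc : 6 * r ^ 2 * A2 = (6 + d) * A + 2 * T) (hd : A + T + P = 6 * Q)
    (b2 : |B2| ≤ M * h) (b3 : |B3| ≤ M * r ^ 2 * h) (bP : 2 * |P| ≤ M * r ^ 2 * (A + h))
    (cJ : J ^ 2 ≤ h * Q) (eI : i = A + B3) (hA : 0 ≤ A) :
    0 < i + (M + 1) * h ∧ -(M * (d + 11)) * (i + (M + 1) * h) * h ≤
        (6 * r * (A2 + B2)) * h - i * (4 * r * H1) := by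
  have hr2 : r ^ 2 ≤ 1 := by nlinarith
  have hMh : 0 ≤ M * h := by positivity
  have hAi : A + h ≤ i + (M + 1) * h := by
    have := neg_abs_le B3
    have : M * r ^ 2 * h ≤ M * h := by nlinarith
    nlinarith
  refine ⟨by linarith, ?_⟩
  have hE : -(M * (d + 11)) * (i + (M + 1) * h) * r ^ 2 ≤
      -(4 + d) * B3 - 2 * P + 6 * r ^ 2 * B2 := by
    have h3 := le_abs_self B3
    have hP := le_abs_self P
    have h2 := neg_abs_le B2
    have hdn : (0 : ℝ) ≤ d := Nat.cast_nonneg d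
    have s1 : (4 + d) * B3 ≤ (4 + d) * (M * r ^ 2 * h) := by
      gcongr; linarith
    have s2 : 2 * P ≤ M * r ^ 2 * (A + h) := by linarith
    have s3 : -(6 * r ^ 2 * (M * h)) ≤ 6 * r ^ 2 * B2 := by
      have : 0 ≤ 6 * r ^ 2 := by positivity
      nlinarith
    have s4 : M * r ^ 2 * ((d + 11) * (A + h)) ≤ M * r ^ 2 * ((d + 11) * (i + (M + 1) * h)) := by
      gcongr
    have s5 : 0 ≤ M * r ^ 2 * ((d + 10) * A) := by positivity
    nlinarith
  have e1 : r * ((6 * r * (A2 + B2)) * h - i * (4 * r * H1)) =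
      h * (12 * Q + (-(4 + d) * B3 - 2 * P + 6 * r ^ 2 * B2)) - 12 * J ^ 2 := by
    have e2 : 4 * r ^ 2 * H1 = (4 + d) * h + 2 * J := ha
    have e3 : 6 * r ^ 2 * A2 = (6 + d) * A + 2 * (6 * Q - A - P) := by linarith
    have : r * ((6 * r * (A2 + B2)) * h - i * (4 * r * H1)) =
      (6 * r ^ 2 * A2) * h + 6 * r ^ 2 * B2 * h - i * (4 * r ^ 2 * H1) := by ring
    rw [this, e2, e3]
    have : A = 6 * J - B3 := by linarith
    subst this
    rw [hb]; ring
  have e4 : r * (-(M * (d + 11)) * (i + (M + 1) * h) * h) ≤ r * ((6 * r * (A2 + B2)) * h - i * (4 * r * H1)) := by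
    rw [e1]
    have s1 : h * (-(M * (d + 11)) * (i + (M + 1) * h) * r ^ 2) ≤
      h * (-(4 + d) * B3 - 2 * P + 6 * r ^ 2 * B2) := mul_le_mul_of_nonneg_left hE hHr.le
    have s2 : 0 ≤ M * (d + 11) * (i + (M + 1) * h) * h := by
      have : 0 ≤ i + (M + 1) * h := by linarith
      positivity
    have s3 : M * (d + 11) * (i + (M + 1) * h) * h * r ^ 2 ≤ M * (d + 11) * (i + (M + 1) * h) * h * r := by
      apply mul_le_mul_of_nonneg_left _ s2
      nlinarith
    linarith
  exact le_of_mul_le_mul_left e4 hr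

lemma split_I {d : ℕ} {u : (Fin d → ℝ) → ℝ} (hu : ContDiff ℝ 2 u) (r : ℝ) (m : ℕ) :
    (∫ x, (gr2 u x + u x * lapR u x) * wt r x ^ (m + 1))
      = (∫ x, gr2 u x * wt r x ^ (m + 1)) + ∫ x, (u x * lapR u x) * wt r x ^ (m + 1) := by
  rw [← integral_add (integrable_wt r m (contDiff_gr2 hu).continuous)
    (integrable_wt r m (g := fun x => u x * lapR u x) (hu.continuous.mul (continuous_lapR hu)))]
  simp only [add_mul]

section freq

variable {d : ℕ} {u : (Fin d → ℝ) → ℝ} {M R : ℝ}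

lemma bound_B (hu : ContDiff ℝ 2 u) (hlap : ∀ x, nsq x < R ^ 2 → |lapR u x| ≤ M * |u x|)
    {r : ℝ} (hr : 0 < r) (hrR : r ≤ R) :
    |∫ x, (u x * lapR u x) * wt r x ^ 2| ≤ M * ∫ x, u x ^ 2 * wt r x ^ 2 := by
  have hc := hu.continuous
  rw [← integral_const_mul]
  refine (abs_integral_le_integral_abs).trans (integral_mono (integrable_wt r 1 (hc.mul (continuous_lapR hu))).abs
    ((integrable_wt r 1 (hc.pow 2)).const_mul _) fun x => ?_)
  by_cases hw : wt r x = 0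
  · simp [hw]
  have h1 := hlap x ((wt_ne_zero hw).trans_le (by gcongr))
  have : |u x| * |lapR u x| ≤ M * u x ^ 2 := by
    rw [← sq_abs (u x)]
    nlinarith [abs_nonneg (u x)]
  simp only [abs_mul, abs_pow, abs_of_nonneg (wt_nonneg r x)]
  nlinarith [pow_nonneg (wt_nonneg r x) 2]

lemma bound_B3 (hu : ContDiff ℝ 2 u) (hlap : ∀ x, nsq x < R ^ 2 → |lapR u x| ≤ M * |u x|)
    {r : ℝ} (hM : 0 ≤ M) (hr : 0 < r) (hrR : r ≤ R) :
    |∫ x, (u x * lapR u x) * wt r x ^ 3| ≤ M * r ^ 2 * ∫ x, u x ^ 2 * wt r x ^ 2 := by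
  have hc := hu.continuous
  rw [← integral_const_mul]
  refine (abs_integral_le_integral_abs).trans (integral_mono (integrable_wt r 2 (hc.mul (continuous_lapR hu))).abs
    ((integrable_wt r 1 (hc.pow 2)).const_mul _) fun x => ?_)
  by_cases hw : wt r x = 0
  · simp [hw]
  have h1 := hlap x ((wt_ne_zero hw).trans_le (by gcongr))
  have : |u x| * |lapR u x| ≤ M * u x ^ 2 := by
    rw [← sq_abs (u x)]
    nlinarith [abs_nonneg (u x)]
  have hw0 := wt_nonneg r x
  have hw1 := wt_le r x
  simp only [abs_mul, abs_pow, abs_of_nonneg hw0]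
  calc |u x| * |lapR u x| * wt r x ^ 3 ≤ (M * u x ^ 2) * (wt r x ^ 2 * r ^ 2) := by
        have : wt r x ^ 3 = wt r x ^ 2 * wt r x := by ring
        rw [this]; gcongr
    _ = _ := by ring

lemma bound_P (hu : ContDiff ℝ 2 u) (hlap : ∀ x, nsq x < R ^ 2 → |lapR u x| ≤ M * |u x|)
    {r : ℝ} (hM : 0 ≤ M) (hr : 0 < r) (hrR : r ≤ R) :
    2 * |∫ x, (rad u x * lapR u x) * wt r x ^ 3| ≤
      M * r ^ 2 * ((∫ x, gr2 u x * wt r x ^ 3) + ∫ x, u x ^ 2 * wt r x ^ 2) := by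
  have hc := hu.continuous
  have hcr := (contDiff_rad hu).continuous
  have i1 := (integrable_wt r 2 (contDiff_gr2 hu).continuous)
  have i2 := integrable_wt r 1 (g := fun x => u x ^ 2) (hc.pow 2)
  have i3 := (integrable_wt r 2 (hcr.mul (continuous_lapR hu)))
  rw [← integral_add i1 i2, ← integral_const_mul]
  refine (mul_le_mul_of_nonneg_left (abs_integral_le_integral_abs) zero_le_two).trans ?_
  rw [← integral_const_mul]
  refine (integral_mono (i3.abs.const_mul 2) ((i1.add i2).const_mul _) fun x => ?_)
  by_cases hw : wt r x = 0
  · simp [hw]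
  have hs := wt_ne_zero hw
  have h1 := hlap x (hs.trans_le (by gcongr))
  have hg := gr2_nonneg u x
  have h3 : rad u x ^ 2 ≤ r ^ 2 * gr2 u x := (rad_sq_le u x).trans (by gcongr)
  have h2 : 2 * (|rad u x| * |lapR u x|) ≤ M * (r ^ 2 * gr2 u x + u x ^ 2) := by
    have : |rad u x| * |lapR u x| ≤ |rad u x| * (M * |u x|) := by gcongr
    have h5 : 2 * (|rad u x| * |u x|) ≤ rad u x ^ 2 + u x ^ 2 := by
      rw [← sq_abs (u x), ← sq_abs (rad u x)]
      nlinarith [sq_nonneg (|rad u x| - |u x|)]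
    nlinarith
  have hw0 := wt_nonneg r x
  have hw1 := wt_le r x
  simp only [abs_mul, abs_pow, abs_of_nonneg hw0]
  calc 2 * (|rad u x| * |lapR u x| * wt r x ^ 3)
      = 2 * (|rad u x| * |lapR u x|) * wt r x ^ 3 := by ring
    _ ≤ (M * (r ^ 2 * gr2 u x + u x ^ 2)) * wt r x ^ 3 := by gcongr
    _ = M * (r ^ 2 * (gr2 u x * wt r x ^ 3) + u x ^ 2 * wt r x ^ 2 * wt r x) := by ring
    _ ≤ M * (r ^ 2 * (gr2 u x * wt r x ^ 3) + u x ^ 2 * wt r x ^ 2 * r ^ 2) := by gcongr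
    _ = _ := by ring

lemma cauchy_J (hu : ContDiff ℝ 2 u) {r : ℝ} (hH : 0 < ∫ x, u x ^ 2 * wt r x ^ 2) :
    (∫ x, (u x * rad u x) * wt r x ^ 2) ^ 2 ≤
      (∫ x, u x ^ 2 * wt r x ^ 2) * ∫ x, rad u x ^ 2 * wt r x ^ 2 := by
  have hc := hu.continuous
  have hcr := (contDiff_rad hu).continuous
  have i1 := (integrable_wt r 1 (hc.pow 2))
  have i2 := (integrable_wt r 1 (hc.mul hcr))
  have i3 := (integrable_wt r 1 (hcr.pow 2))
  set H := ∫ x, u x ^ 2 * wt r x ^ 2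
  set J := ∫ x, (u x * rad u x) * wt r x ^ 2
  set Q := ∫ x, rad u x ^ 2 * wt r x ^ 2
  have key : 0 ≤ H ^ 2 * Q + (-2 * H * J) * J + J ^ 2 * H := by
    have : H ^ 2 * Q + (-2 * H * J) * J + J ^ 2 * H =
        ∫ x, (H * rad u x - J * u x) ^ 2 * wt r x ^ 2 := by
      have e : ∀ x, (H * rad u x - J * u x) ^ 2 * wt r x ^ 2 =
        (H ^ 2 * (rad u x ^ 2 * wt r x ^ 2) + (-2 * H * J) * ((u x * rad u x) * wt r x ^ 2)) +
          J ^ 2 * (u x ^ 2 * wt r x ^ 2) := fun x => by ring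
      simp_rw [e]
      rw [integral_add, integral_add]
      · simp_rw [integral_const_mul]; rfl
      · exact i3.const_mul _
      · exact i2.const_mul _
      · exact (i3.const_mul _).add (i2.const_mul _)
      · exact i1.const_mul _
    rw [this]
    exact integral_nonneg fun x => by positivity
  have : 0 ≤ H * (H * Q - J ^ 2) := by nlinarith
  have := nonneg_of_mul_nonneg_right this hH
  linarith

lemma freq_step (hu : ContDiff ℝ 2 u) (hM : 0 ≤ M) (hR1 : R ≤ 1)
    (hlap : ∀ x, nsq x < R ^ 2 → |lapR u x| ≤ M * |u x|) :
    ∃ K : ℝ, ∀ r0, 0 < r0 → r0 ≤ R → (∀ r ∈ Icc r0 R, 0 < ∫ x, u x ^ 2 * wt r x ^ 2) →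
      (∫ x, (gr2 u x + u x * lapR u x) * wt r0 x ^ 3) ≤ K * ∫ x, u x ^ 2 * wt r0 x ^ 2 := by
  have hc := hu.continuous
  have hcg := (contDiff_gr2 hu).continuous
  have hcl := continuous_lapR hu
  set H : ℝ → ℝ := fun r => ∫ x, u x ^ 2 * wt r x ^ 2 with hHdef
  set I : ℝ → ℝ := fun r => ∫ x, (gr2 u x + u x * lapR u x) * wt r x ^ 3 with hIdef
  set C : ℝ := M * (d + 11)
  set Φ : ℝ → ℝ := fun r => Real.exp (C * r) * (I r / H r + (M + 1))
  have hH' : ∀ r, HasDerivAt H (4 * r * ∫ x, u x ^ 2 * wt r x ^ 1) r := fun r => by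
    have := hasDerivAt_wt r 0 (hc.pow 2)
    norm_num at this ⊢
    exact this
  have hI' : ∀ r, HasDerivAt I (6 * r * ∫ x, (gr2 u x + u x * lapR u x) * wt r x ^ 2) r := fun r => by
    have := hasDerivAt_wt r 1 (hcg.add (hc.mul hcl))
    norm_num at this ⊢
    exact this
  -- the lower bound I + (M+1) H ≥ A + H
  have facts : ∀ r, 0 < r → r ≤ R → 0 < H r →
      0 < I r + (M + 1) * H r ∧
      -C * (I r + (M + 1) * H r) * H r ≤
        (6 * r * ∫ x, (gr2 u x + u x * lapR u x) * wt r x ^ 2) * H r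
          - I r * (4 * r * ∫ x, u x ^ 2 * wt r x ^ 1) := by
    intro r hr hrR hHr
    have hr1 : r ≤ 1 := hrR.trans hR1
    have ha := id_a hu r
    have hb := id_b hu r
    have hcc := id_c hu r
    have hd := id_d hu r
    have b2 := bound_B hu hlap hr hrR
    have b3 := bound_B3 hu hlap hM hr hrR
    have bP := bound_P hu hlap hM hr hrR
    have cJ := cauchy_J hu hHr
    have eI : I r = (∫ x, gr2 u x * wt r x ^ 3) + ∫ x, (u x * lapR u x) * wt r x ^ 3 := by
      exact split_I hu r 2
    have eI2 : (∫ x, (gr2 u x + u x * lapR u x) * wt r x ^ 2)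
        = (∫ x, gr2 u x * wt r x ^ 2) + ∫ x, (u x * lapR u x) * wt r x ^ 2 := by
      exact split_I hu r 1
    have hA : 0 ≤ ∫ x, gr2 u x * wt r x ^ 3 := integral_nonneg fun x =>
      mul_nonneg (gr2_nonneg u x) (pow_nonneg (wt_nonneg r x) 3)
    rw [eI2]
    have eH : (∫ x, u x ^ 2 * wt r x ^ 2) = H r := rfl
    have eI' : (∫ x, (gr2 u x + u x * lapR u x) * wt r x ^ 3) = I r := rfl
    rw [eH] at ha b2 b3 bP cJ
    rw [eI'] at hb
    generalize (∫ x, u x ^ 2 * wt r x ^ 1) = H1 at *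
    generalize (∫ x, (u x * rad u x) * wt r x ^ 2) = J at *
    generalize (∫ x, gr2 u x * wt r x ^ 3) = A at *
    generalize (∫ x, gr2 u x * wt r x ^ 2) = A2 at *
    generalize (∫ x, mixT u x * wt r x ^ 3) = T at *
    generalize (∫ x, (rad u x * lapR u x) * wt r x ^ 3) = P at *
    generalize (∫ x, rad u x ^ 2 * wt r x ^ 2) = Q at *
    generalize (∫ x, (u x * lapR u x) * wt r x ^ 3) = B3 at *
    generalize (∫ x, (u x * lapR u x) * wt r x ^ 2) = B2 at *
    generalize H r = h at *
    generalize I r = i at *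
    exact freq_alg hM hr hr1 hHr ha hb hcc hd b2 b3 bP cJ eI hA
  refine ⟨Φ R, fun r0 hr0 hr0R hpos => ?_⟩
  have hΦ' : ∀ r ∈ Icc r0 R, HasDerivAt Φ
      (C * Real.exp (C * r) * (I r / H r + (M + 1)) + Real.exp (C * r) *
        (((6 * r * ∫ x, (gr2 u x + u x * lapR u x) * wt r x ^ 2) * H r
          - I r * (4 * r * ∫ x, u x ^ 2 * wt r x ^ 1)) / H r ^ 2)) r := by
    intro r hr
    have hne : H r ≠ 0 := (hpos r hr).ne'
    have h1 : HasDerivAt (fun r => Real.exp (C * r)) (C * Real.exp (C * r)) r := by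
      have := ((hasDerivAt_id r).const_mul C).exp
      simpa [mul_comm] using this
    exact h1.mul (((hI' r).div (hH' r) hne).add_const (M + 1))
  have hmono : MonotoneOn Φ (Icc r0 R) := by
    apply monotoneOn_of_deriv_nonneg (convex_Icc _ _)
    · exact fun r hr => (hΦ' r hr).continuousAt.continuousWithinAt
    · intro r hr
      rw [interior_Icc] at hr
      exact (hΦ' r (Ioo_subset_Icc_self hr)).differentiableAt.differentiableWithinAt
    · intro r hr
      rw [interior_Icc] at hr
      have hr' := Ioo_subset_Icc_self hr
      rw [(hΦ' r hr').deriv]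
      have hHr : 0 < H r := hpos r hr'
      obtain ⟨f1, f2⟩ := facts r (hr0.trans_le hr'.1) hr'.2 hHr
      generalize ((6 * r * ∫ x, (gr2 u x + u x * lapR u x) * wt r x ^ 2) * H r
          - I r * (4 * r * ∫ x, u x ^ 2 * wt r x ^ 1)) = G at *
      have e : C * Real.exp (C * r) * (I r / H r + (M + 1)) + Real.exp (C * r) * (G / H r ^ 2)
        = Real.exp (C * r) * ((C * (I r + (M + 1) * H r) * H r + G) / H r ^ 2) := by
        field_simp
      rw [e]
      apply mul_nonneg (Real.exp_pos _).le
      apply div_nonneg _ (sq_nonneg _)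
      linarith
  have h1 := hmono (left_mem_Icc.2 hr0R) (right_mem_Icc.2 hr0R) hr0R
  have hH0 : 0 < H r0 := hpos r0 (left_mem_Icc.2 hr0R)
  obtain ⟨f1, -⟩ := facts r0 hr0 hr0R hH0
  have hN : 0 < I r0 / H r0 + (M + 1) := by
    have : I r0 / H r0 + (M + 1) = (I r0 + (M + 1) * H r0) / H r0 := by field_simp
    rw [this]; positivity
  have hexp : 1 ≤ Real.exp (C * r0) := by
    apply Real.one_le_exp; positivity
  have h2 : I r0 / H r0 ≤ Φ R := by
    have : I r0 / H r0 + (M + 1) ≤ Φ r0 := by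
      change _ ≤ Real.exp (C * r0) * (I r0 / H r0 + (M + 1))
      nlinarith
    linarith
  rwa [div_le_iff₀ hH0] at h2

/-- Frequency bound: either the solution vanishes near zero or the frequency is bounded. -/
lemma freq_bound (hu : ContDiff ℝ 2 u) (hM : 0 ≤ M) (hR : 0 < R) (hR1 : R ≤ 1)
    (hlap : ∀ x, nsq x < R ^ 2 → |lapR u x| ≤ M * |u x|)
    (hne : ∫ x, u x ^ 2 * wt R x ^ 2 ≠ 0) :
    ∃ K : ℝ, 0 ≤ K ∧ ∀ r, 0 < r → r ≤ R → 0 < ∫ x, u x ^ 2 * wt r x ^ 2 ∧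
      (∫ x, gr2 u x * wt r x ^ 3) ≤ K * (∫ x, u x ^ 2 * wt r x ^ 2) ∧
      r ^ 2 * (∫ x, u x ^ 2 * wt r x ^ 1) ≤ K * ∫ x, u x ^ 2 * wt r x ^ 2 := by
  have hc := hu.continuous
  have hcg := (contDiff_gr2 hu).continuous
  have hcl := continuous_lapR hu
  obtain ⟨K0, hK0⟩ := freq_step hu hM hR1 hlap
  set H : ℝ → ℝ := fun r => ∫ x, u x ^ 2 * wt r x ^ 2 with hHdef
  have hH' : ∀ r, HasDerivAt H (4 * r * ∫ x, u x ^ 2 * wt r x ^ 1) r := fun r => by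
    have := hasDerivAt_wt r 0 (hc.pow 2)
    norm_num at this ⊢
    exact this
  have hcont : Continuous H := continuous_iff_continuousAt.2 fun r => (hH' r).continuousAt
  have hnn : ∀ r, 0 ≤ H r := fun r => integral_nonneg fun x => by positivity
  have hHR : 0 < H R := lt_of_le_of_ne (hnn R) (Ne.symm hne)
  set K1 : ℝ := 4 + d + |K0|
  have hK1 : 0 < K1 := by positivity
  have step1 : ∀ r0, 0 < r0 → r0 ≤ R → (∀ r ∈ Icc r0 R, 0 < H r) →
      4 * r0 ^ 2 * (∫ x, u x ^ 2 * wt r0 x ^ 1) ≤ K1 * H r0 := by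
    intro r0 h0 h0R hp
    have h1 := hK0 r0 h0 h0R hp
    have hb := id_b hu r0
    have ha := id_a hu r0
    have h2 := hp r0 (left_mem_Icc.2 h0R)
    have e : (∫ x, u x ^ 2 * wt r0 x ^ 2) = H r0 := rfl
    rw [e] at ha h1
    rw [ha]
    have : K0 * H r0 ≤ |K0| * H r0 := by gcongr; exact le_abs_self _
    have : 0 ≤ |K0| * H r0 := by positivity
    change _ ≤ (4 + d + |K0|) * H r0
    nlinarith
  have hpos : ∀ r, 0 < r → r ≤ R → 0 < H r := by
    intro a ha haR
    by_contra hcon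
    have hHa : H a = 0 := le_antisymm (not_lt.1 hcon) (hnn a)
    have hcomp : IsCompact (Icc a R ∩ H ⁻¹' {0}) :=
      isCompact_Icc.inter_right (isClosed_singleton.preimage hcont)
    obtain ⟨b, hb⟩ := hcomp.exists_isGreatest ⟨a, ⟨le_rfl, haR⟩, hHa⟩
    obtain ⟨⟨⟨hab, hbR⟩, hHb⟩, hbmax⟩ := hb
    have hHb' : H b = 0 := hHb
    have hb0 : 0 < b := ha.trans_le hab
    have hbR' : b < R := lt_of_le_of_ne hbR (fun h => by rw [h] at hHb'; exact hne hHb')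
    have hp : ∀ r, b < r → r ≤ R → 0 < H r := by
      intro r hbr hrR
      refine lt_of_le_of_ne (hnn r) fun h => ?_
      exact absurd (hbmax ⟨⟨hab.trans hbr.le, hrR⟩, h.symm⟩) (not_le.2 hbr)
    set c := K1 / b
    set G : ℝ → ℝ := fun r => H r * Real.exp (-(c * r))
    have hG' : ∀ r, HasDerivAt G ((4 * r * ∫ x, u x ^ 2 * wt r x ^ 1) * Real.exp (-(c * r)) +
        H r * (-c * Real.exp (-(c * r)))) r := by
      intro r
      have h1 : HasDerivAt (fun r => Real.exp (-(c * r))) (-c * Real.exp (-(c * r))) r := by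
        have := (((hasDerivAt_id r).const_mul c).neg).exp
        simpa [mul_comm] using this
      exact (hH' r).mul h1
    have hanti : AntitoneOn G (Icc b R) := by
      apply antitoneOn_of_deriv_nonpos (convex_Icc _ _)
      · exact fun r hr => (hG' r).continuousAt.continuousWithinAt
      · exact fun r hr => (hG' r).differentiableAt.differentiableWithinAt
      · intro r hr
        rw [interior_Icc] at hr
        rw [(hG' r).deriv]
        have hr0 : 0 < r := hb0.trans hr.1
        have h1 := step1 r hr0 hr.2.le (fun ρ hρ => hp ρ (hr.1.trans_le hρ.1) hρ.2)
        have hHr := hp r hr.1 hr.2.le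
        have h2 : 4 * r * (∫ x, u x ^ 2 * wt r x ^ 1) ≤ c * H r := by
          have h3 : 4 * r * (∫ x, u x ^ 2 * wt r x ^ 1) ≤ K1 * H r / r := by
            rw [le_div_iff₀ hr0]; linarith
          refine h3.trans ?_
          have : c * H r = K1 * H r / b := by simp only [c]; ring
          rw [this]
          gcongr
          exact hr.1.le
        have := Real.exp_pos (-(c * r))
        nlinarith
    have h1 := hanti (left_mem_Icc.2 hbR) (right_mem_Icc.2 hbR) hbR
    simp only [G, hHb', zero_mul] at h1
    have : 0 < H R * Real.exp (-(c * R)) := by positivity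
    linarith
  refine ⟨K1 + M, by positivity, fun r hr hrR => ⟨hpos r hr hrR, ?_, ?_⟩⟩
  · have h1 := hK0 r hr hrR (fun ρ hρ => hpos ρ (hr.trans_le hρ.1) hρ.2)
    have b3 := bound_B3 hu hlap hM hr hrR
    have eI : (∫ x, (gr2 u x + u x * lapR u x) * wt r x ^ 3)
        = (∫ x, gr2 u x * wt r x ^ 3) + ∫ x, (u x * lapR u x) * wt r x ^ 3 := by
      exact split_I hu r 2
    rw [eI] at h1
    have e : (∫ x, u x ^ 2 * wt r x ^ 2) = H r := rfl
    rw [e] at *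
    have h2 := hpos r hr hrR
    have h3 : K0 * H r ≤ K1 * H r := by
      gcongr
      have := le_abs_self K0
      have : (0 : ℝ) ≤ d := Nat.cast_nonneg d
      simp only [K1]; linarith
    have h4 := neg_abs_le (∫ x, (u x * lapR u x) * wt r x ^ 3)
    have h5 : M * r ^ 2 * H r ≤ M * H r := by
      have : r ^ 2 ≤ 1 := by nlinarith
      have : 0 ≤ M * H r := by positivity
      nlinarith
    nlinarith
  · have h1 := step1 r hr hrR (fun ρ hρ => hpos ρ (hr.trans_le hρ.1) hρ.2)
    have h2 := hpos r hr hrR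
    have h3 : 0 ≤ ∫ x, u x ^ 2 * wt r x ^ 1 :=
      integral_nonneg fun x => mul_nonneg (sq_nonneg _) (pow_nonneg (wt_nonneg r x) 1)
    have h4 : 0 ≤ r ^ 2 * ∫ x, u x ^ 2 * wt r x ^ 1 := by positivity
    have h5 : 0 ≤ M * H r := by positivity
    change _ ≤ (K1 + M) * H r
    nlinarith

end freq

lemma translate_bound {d : ℕ} {f : (Fin d → ℝ) → ℝ} (hf : ContDiff ℝ 1 f) (h : Fin d → ℝ) :
    ∫⁻ x, ‖f (x + h) - f x‖ₑ ≤ ‖h‖ₑ * ∫⁻ x, ‖fderiv ℝ f x‖ₑ := by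
  have hcf : Continuous (fderiv ℝ f) := hf.continuous_fderiv one_ne_zero
  have h1 : ∀ x, ‖f (x + h) - f x‖ₑ ≤ ∫⁻ t in Ioc (0 : ℝ) 1, ‖fderiv ℝ f (x + t • h)‖ₑ * ‖h‖ₑ := by
    intro x
    have hd : ∀ t : ℝ, HasDerivAt (fun t : ℝ => f (x + t • h)) (fderiv ℝ f (x + t • h) h) t := by
      intro t
      have h2 : HasDerivAt (fun t : ℝ => x + t • h) h t := by
        simpa using ((hasDerivAt_id t).smul_const h).const_add x
      exact (hf.differentiable one_ne_zero (x + t • h)).hasFDerivAt.comp_hasDerivAt t h2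
    have hcont : Continuous fun t : ℝ => fderiv ℝ f (x + t • h) h := by fun_prop
    have h3 := intervalIntegral.integral_eq_sub_of_hasDerivAt (a := 0) (b := 1) (fun t _ => hd t)
      (hcont.intervalIntegrable _ _)
    simp only [one_smul, zero_smul, add_zero] at h3
    rw [← h3, intervalIntegral.integral_of_le zero_le_one]
    refine (enorm_integral_le_lintegral_enorm _).trans (lintegral_mono fun t => ?_)
    exact ContinuousLinearMap.le_opENorm _ _
  calc ∫⁻ x, ‖f (x + h) - f x‖ₑ
      ≤ ∫⁻ x, ∫⁻ t in Ioc (0 : ℝ) 1, ‖fderiv ℝ f (x + t • h)‖ₑ * ‖h‖ₑ := lintegral_mono h1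
    _ = ∫⁻ t in Ioc (0 : ℝ) 1, ∫⁻ x, ‖fderiv ℝ f (x + t • h)‖ₑ * ‖h‖ₑ := by
        apply lintegral_lintegral_swap
        apply Measurable.aemeasurable
        have : Continuous fun p : (Fin d → ℝ) × ℝ => fderiv ℝ f (p.1 + p.2 • h) := by fun_prop
        exact (this.enorm.measurable).mul_const _
    _ = ∫⁻ t in Ioc (0 : ℝ) 1, ‖h‖ₑ * ∫⁻ x, ‖fderiv ℝ f x‖ₑ := by
        congr 1; ext t
        rw [lintegral_mul_const _ (by fun_prop), lintegral_add_right_eq_self (fun x => ‖fderiv ℝ f x‖ₑ),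
          mul_comm]
    _ = _ := by simp

lemma small_support_l {d : ℕ} {f : (Fin d → ℝ) → ℝ} (hf : ContDiff ℝ 1 f) {ρ : ℝ} (hρ : 0 < ρ)
    (hvol : volume {x | f x ≠ 0} ≤ volume (Metric.ball (0 : Fin d → ℝ) ρ) / 2) :
    ∫⁻ x, ‖f x‖ₑ ≤ 2 * ENNReal.ofReal ρ * ∫⁻ x, ‖fderiv ℝ f x‖ₑ := by
  set B := Metric.ball (0 : Fin d → ℝ) ρ
  have hB0 : volume B ≠ 0 := (Metric.measure_ball_pos volume _ hρ).ne'
  have hBt : volume B ≠ ⊤ := measure_ball_lt_top.ne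
  have hc := hf.continuous
  have lower : ∀ x, volume B / 2 * ‖f x‖ₑ ≤ ∫⁻ h in B, ‖f (x + h) - f x‖ₑ := by
    intro x
    set S := {h : Fin d → ℝ | f (x + h) = 0}
    have hSm : MeasurableSet S := (isClosed_singleton.preimage (hc.comp (continuous_const.add continuous_id))).measurableSet
    have hSc : volume Sᶜ ≤ volume B / 2 := by
      have : Sᶜ = (fun h => x + h) ⁻¹' {x | f x ≠ 0} := rfl
      rw [this, measure_preimage_add]
      exact hvol
    have h1 : volume B / 2 ≤ volume (B ∩ S) := by
      have h2 : volume B ≤ volume (B ∩ S) + volume B / 2 := by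
        calc volume B ≤ volume (B ∩ S) + volume (B \ S) := measure_le_inter_add_sdiff _ _ _
          _ ≤ _ := by
            gcongr
            exact (measure_mono fun y hy => hy.2).trans hSc
      have h3 : volume B / 2 + volume B / 2 = volume B := ENNReal.add_halves _
      have hfin : volume B / 2 ≠ ⊤ := ENNReal.div_ne_top hBt two_ne_zero
      rw [← ENNReal.add_le_add_iff_right hfin, h3]
      exact h2
    calc volume B / 2 * ‖f x‖ₑ ≤ volume (B ∩ S) * ‖f x‖ₑ := by gcongr
      _ = ∫⁻ h in B ∩ S, ‖f x‖ₑ := by rw [lintegral_const]; simp [mul_comm]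
      _ = ∫⁻ h in B ∩ S, ‖f (x + h) - f x‖ₑ := by
          apply setLIntegral_congr_fun (measurableSet_ball.inter hSm)
          intro h hh
          have : f (x + h) = 0 := hh.2
          simp [this]
      _ ≤ _ := lintegral_mono_set inter_subset_left
  have h1 : volume B / 2 * ∫⁻ x, ‖f x‖ₑ ≤ ENNReal.ofReal ρ * (∫⁻ x, ‖fderiv ℝ f x‖ₑ) * volume B := by
    calc volume B / 2 * ∫⁻ x, ‖f x‖ₑ = ∫⁻ x, volume B / 2 * ‖f x‖ₑ := by
          rw [lintegral_const_mul _ (by fun_prop)]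
      _ ≤ ∫⁻ x, ∫⁻ h in B, ‖f (x + h) - f x‖ₑ := lintegral_mono lower
      _ = ∫⁻ h in B, ∫⁻ x, ‖f (x + h) - f x‖ₑ := by
          apply lintegral_lintegral_swap
          apply Measurable.aemeasurable
          have : Continuous fun p : (Fin d → ℝ) × (Fin d → ℝ) => f (p.1 + p.2) - f p.1 := by fun_prop
          exact this.enorm.measurable
      _ ≤ ∫⁻ h in B, ENNReal.ofReal ρ * ∫⁻ x, ‖fderiv ℝ f x‖ₑ := by
          apply setLIntegral_mono measurable_const
          intro h hh
          refine (translate_bound hf h).trans ?_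
          gcongr
          rw [← ofReal_norm]
          apply ENNReal.ofReal_le_ofReal
          exact (mem_ball_zero_iff.1 hh).le
      _ = _ := by rw [lintegral_const]; simp
  have h2 : volume B * ∫⁻ x, ‖f x‖ₑ ≤ volume B * (2 * ENNReal.ofReal ρ * ∫⁻ x, ‖fderiv ℝ f x‖ₑ) := by
    calc volume B * ∫⁻ x, ‖f x‖ₑ = 2 * (volume B / 2 * ∫⁻ x, ‖f x‖ₑ) := by
          rw [← mul_assoc, ENNReal.mul_div_cancel two_ne_zero (by simp)]
      _ ≤ 2 * (ENNReal.ofReal ρ * (∫⁻ x, ‖fderiv ℝ f x‖ₑ) * volume B) := by gcongr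
      _ = _ := by ring
  exact (ENNReal.mul_le_mul_iff_right hB0 hBt).1 h2

lemma small_support {d : ℕ} {f : (Fin d → ℝ) → ℝ} (hf : ContDiff ℝ 1 f) (hfc : HasCompactSupport f)
    (hf0 : ∀ x, 0 ≤ f x) {ρ : ℝ} (hρ : 0 < ρ)
    (hvol : volume {x | f x ≠ 0} ≤ volume (Metric.ball (0 : Fin d → ℝ) ρ) / 2) :
    ∫ x, f x ≤ 2 * ρ * ∫ x, ‖fderiv ℝ f x‖ := by
  have h := small_support_l hf hρ hvol
  have hi : Integrable f := hf.continuous.integrable_of_hasCompactSupport hfc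
  have hi' : Integrable (fun x => ‖fderiv ℝ f x‖) :=
    ((hf.continuous_fderiv one_ne_zero).integrable_of_hasCompactSupport (hfc.fderiv ℝ)).norm
  have e1 : ∫⁻ x, ‖f x‖ₑ = ENNReal.ofReal (∫ x, f x) := by
    rw [ofReal_integral_eq_lintegral_ofReal hi (Eventually.of_forall hf0)]
    congr 1; ext x
    rw [← ofReal_norm, Real.norm_of_nonneg (hf0 x)]
  have e2 : ∫⁻ x, ‖fderiv ℝ f x‖ₑ = ENNReal.ofReal (∫ x, ‖fderiv ℝ f x‖) := by
    rw [ofReal_integral_eq_lintegral_ofReal hi' (Eventually.of_forall fun x => norm_nonneg _)]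
    congr 1; ext x
    rw [← ofReal_norm]
  have h0 : 0 ≤ ∫ x, ‖fderiv ℝ f x‖ := integral_nonneg fun x => norm_nonneg _
  rw [e1, e2, show (2 : ENNReal) = ENNReal.ofReal 2 by simp, ← ENNReal.ofReal_mul (by norm_num),
    ← ENNReal.ofReal_mul (by positivity)] at h
  exact (ENNReal.ofReal_le_ofReal_iff (by positivity)).1 h

lemma opNorm_le_sum {d : ℕ} (L : (Fin d → ℝ) →L[ℝ] ℝ) : ‖L‖ ≤ ∑ i, |L (Pi.single i 1)| := by
  apply L.opNorm_le_bound (Finset.sum_nonneg fun i _ => abs_nonneg _)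
  intro y
  have : L y = ∑ i, y i * L (Pi.single i 1) := by
    conv_lhs => rw [pi_eq_sum_univ' y]
    rw [map_sum]
    refine Finset.sum_congr rfl fun i _ => ?_
    rw [map_smul, smul_eq_mul]
    
  rw [this, Finset.sum_mul]
  refine (norm_sum_le _ _).trans (Finset.sum_le_sum fun i _ => ?_)
  rw [norm_mul, mul_comm]
  exact mul_le_mul_of_nonneg_left (norm_le_pi_norm y i) (norm_nonneg _)

lemma vanish_of_density {d : ℕ} {u : (Fin d → ℝ) → ℝ} {M R : ℝ}
    (hu : ContDiff ℝ 2 u) (hM : 0 ≤ M) (hR : 0 < R) (hR1 : R ≤ 1)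
    (hlap : ∀ x, nsq x < R ^ 2 → |lapR u x| ≤ M * |u x|)
    (hdens : ∀ δ : ℝ, 0 < δ → ∀ᶠ r in 𝓝[>] (0 : ℝ), volume (Metric.closedBall 0 r ∩ {x | u x ≠ 0}) ≤
      ENNReal.ofReal δ * volume (Metric.closedBall (0 : Fin d → ℝ) r)) :
    ∀ x, nsq x < R ^ 2 → u x = 0 := by
  have hu1 : ContDiff ℝ 1 u := hu.of_le (by norm_num)
  by_cases hne : ∫ x, u x ^ 2 * wt R x ^ 2 = 0
  · intro x hx
    by_contra hux
    have hcont : Continuous fun x => u x ^ 2 * wt R x ^ 2 :=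
      (hu.continuous.pow 2).mul ((continuous_wt R).pow 2)
    have := hcont.integral_pos_of_hasCompactSupport_nonneg_nonzero (μ := volume)
      (hcs_wt R 1 (fun x => u x ^ 2)) (fun x => by positivity) (x := x) (by
        have : wt R x = R ^ 2 - nsq x := max_eq_left (by linarith)
        have h2 : wt R x ≠ 0 := by rw [this]; linarith
        positivity)
    linarith
  exfalso
  obtain ⟨K, hK0, hK⟩ := freq_bound hu hM hR hR1 hlap hne
  set θ : ℝ := 1 / (4 * ((5 * d + 1) * K + 1)) with hθ
  have hden : 0 < 4 * ((5 * (d : ℝ) + 1) * K + 1) := by positivity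
  have hθ0 : 0 < θ := by positivity
  have hev : ∀ᶠ r in 𝓝[>] (0 : ℝ), 0 < r ∧ r ≤ R := by
    filter_upwards [Ioc_mem_nhdsGT hR] with r hr using hr
  obtain ⟨r, hr2, hr, hrR⟩ := ((hdens (θ ^ d / 2) (by positivity)).and hev).exists
  obtain ⟨hH, hA, hH1⟩ := hK r hr hrR
  set f : (Fin d → ℝ) → ℝ := fun x => u x ^ 2 * wt r x ^ 2
  have hwd : ∀ x, HasFDerivAt (fun x => wt r x ^ 2) _ x := hasFDerivAt_wt (d := d) r 0
  have hwC : ContDiff ℝ 1 (fun x : Fin d → ℝ => wt r x ^ 2) := by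
    rw [contDiff_one_iff_fderiv]
    refine ⟨fun x => (hwd x).differentiableAt, ?_⟩
    have : fderiv ℝ (fun x : Fin d → ℝ => wt r x ^ 2) = _ := funext fun x => (hwd x).fderiv
    rw [this]
    have := continuous_wt (d := d) r
    fun_prop
  have hfC : ContDiff ℝ 1 f := (hu1.pow 2).mul hwC
  have hpd : ∀ i x, pd i f x = u x ^ 2 * (-4 * (x i * wt r x)) + 2 * u x * pd i u x * wt r x ^ 2 := by
    intro i x
    have hux : DifferentiableAt ℝ u x := hu1.differentiable one_ne_zero x
    have := pd_mul i (hux.fun_pow 2) (hwd x).differentiableAt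
    have h3 := pd_wt r 0 i x
    simp only [zero_add, pow_one] at h3
    rw [h3, pd_sq i hux] at this
    rw [show pd i f x = _ from this]
    norm_num
  have hvol : volume {x | f x ≠ 0} ≤ volume (Metric.ball (0 : Fin d → ℝ) (θ * r)) / 2 := by
    have h1 : {x | f x ≠ 0} ⊆ Metric.closedBall 0 r ∩ {x | u x ≠ 0} := by
      intro x hx
      have hx' : u x ^ 2 * wt r x ^ 2 ≠ 0 := hx
      refine ⟨?_, fun h => hx' (by rw [h]; simp)⟩
      by_contra h
      rw [← abs_of_pos hr] at h
      exact hx' (by rw [wt_supp r x h]; simp)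
    refine (measure_mono h1).trans (hr2.trans (le_of_eq ?_))
    rw [Real.volume_pi_closedBall _ hr.le, Real.volume_pi_ball _ (by positivity)]
    rw [← ENNReal.ofReal_mul (by positivity), show (2 : ENNReal) = ENNReal.ofReal 2 by simp,
      ← ENNReal.ofReal_div_of_pos two_pos]
    congr 1
    simp only [Fintype.card_fin]
    rw [show 2 * (θ * r) = θ * (2 * r) by ring, mul_pow]
    ring
  have key := small_support hfC (hcs_wt r 1 (fun x => u x ^ 2)) (fun x => by positivity)
    (mul_pos hθ0 hr) hvol
  have i1 := integrable_wt r 0 (g := fun x => u x ^ 2) (hu.continuous.pow 2)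
  have i2 := integrable_wt r 2 (contDiff_gr2 hu).continuous
  have hb : r * ∫ x, ‖fderiv ℝ f x‖ ≤
      5 * d * (r ^ 2 * ∫ x, u x ^ 2 * wt r x ^ 1) + ∫ x, gr2 u x * wt r x ^ 3 := by
    rw [← integral_const_mul, ← integral_const_mul, ← integral_const_mul, ← integral_add]
    · apply integral_mono
      · exact (((hfC.continuous_fderiv one_ne_zero).integrable_of_hasCompactSupport
          ((hcs_wt r 1 (fun x => u x ^ 2)).fderiv ℝ)).norm).const_mul _
      · exact ((i1.const_mul _).const_mul _).add i2
      intro x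
      have hw := wt_nonneg r x
      have h1 : ∀ i, r * |pd i f x| ≤ 5 * (r ^ 2 * (u x ^ 2 * wt r x ^ 1)) + pd i u x ^ 2 * wt r x ^ 3 := by
        intro i
        rw [hpd]
        by_cases hw0 : wt r x = 0
        · simp [hw0]
        have hxi : |x i| ≤ r := by
          have := norm_le_of_sq hr.le (wt_ne_zero hw0).le
          exact (norm_le_pi_norm x i).trans this
        have a1 : |u x ^ 2 * (-4 * (x i * wt r x)) + 2 * u x * pd i u x * wt r x ^ 2| ≤
            4 * (u x ^ 2 * wt r x) * |x i| + 2 * (|u x| * |pd i u x|) * wt r x ^ 2 := by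
          refine (abs_add_le _ _).trans (le_of_eq ?_)
          simp only [abs_mul, abs_pow, sq_abs, abs_neg, abs_of_nonneg hw, Nat.abs_ofNat]
          ring
        have a2 : 4 * (u x ^ 2 * wt r x) * |x i| ≤ 4 * (u x ^ 2 * wt r x) * r := by gcongr
        have a3 : 0 ≤ wt r x * (r * |u x| - |pd i u x| * wt r x) ^ 2 := by positivity
        have a4 : r * |u x ^ 2 * (-4 * (x i * wt r x)) + 2 * u x * pd i u x * wt r x ^ 2| ≤
          r * (4 * (u x ^ 2 * wt r x) * r + 2 * (|u x| * |pd i u x|) * wt r x ^ 2) := by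
          gcongr; linarith
        refine a4.trans ?_
        rw [← sq_abs (u x), ← sq_abs (pd i u x)]
        linarith
      calc r * ‖fderiv ℝ f x‖ ≤ r * ∑ i, |pd i f x| := by
            gcongr; exact opNorm_le_sum _
        _ = ∑ i, r * |pd i f x| := Finset.mul_sum _ _ _
        _ ≤ ∑ i, (5 * (r ^ 2 * (u x ^ 2 * wt r x ^ 1)) + pd i u x ^ 2 * wt r x ^ 3) :=
            Finset.sum_le_sum fun i _ => h1 i
        _ = _ := by
            rw [Finset.sum_add_distrib]
            have h9 : ∑ i, pd i u x ^ 2 * wt r x ^ 3 = gr2 u x * wt r x ^ 3 :=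
              (Finset.sum_mul _ _ _).symm
            rw [h9]
            simp only [Finset.sum_const, Finset.card_univ, Fintype.card_fin, nsmul_eq_mul]
            ring
    · exact (i1.const_mul _).const_mul _
    · exact i2
  have eH : ∫ x, f x = ∫ x, u x ^ 2 * wt r x ^ 2 := rfl
  rw [eH] at key
  set H := ∫ x, u x ^ 2 * wt r x ^ 2
  have h5 : r * ∫ x, ‖fderiv ℝ f x‖ ≤ (5 * d + 1) * K * H := by
    have : 5 * (d : ℝ) * (r ^ 2 * ∫ x, u x ^ 2 * wt r x ^ 1) ≤ 5 * d * (K * H) := by gcongr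
    linarith
  have h6 : H ≤ 2 * θ * ((5 * d + 1) * K * H) := by
    calc H ≤ 2 * (θ * r) * ∫ x, ‖fderiv ℝ f x‖ := key
      _ = 2 * θ * (r * ∫ x, ‖fderiv ℝ f x‖) := by ring
      _ ≤ _ := by gcongr
  have h7 : θ * (4 * ((5 * (d : ℝ) + 1) * K + 1)) = 1 := by
    rw [hθ]; field_simp
  nlinarith [mul_pos hθ0 hH]

lemma pd_congr {d : ℕ} (i : Fin d) {f g : (Fin d → ℝ) → ℝ} {x : Fin d → ℝ} (h : f =ᶠ[𝓝 x] g) :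
    pd i f =ᶠ[𝓝 x] pd i g := by
  filter_upwards [h.fderiv (𝕜 := ℝ)] with y hy
  simp [pd, hy]

lemma lapR_congr {d : ℕ} {f g : (Fin d → ℝ) → ℝ} {x : Fin d → ℝ} (h : f =ᶠ[𝓝 x] g) :
    lapR f x = lapR g x :=
  Finset.sum_congr rfl fun i _ => (pd_congr i (pd_congr i h)).eq_of_nhds

lemma pd_translate {d : ℕ} (i : Fin d) (f : (Fin d → ℝ) → ℝ) (a : Fin d → ℝ) :
    pd i (fun x => f (x + a)) = fun x => pd i f (x + a) := by
  ext x; simp [pd, fderiv_comp_add_right]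

lemma lapR_translate {d : ℕ} (f : (Fin d → ℝ) → ℝ) (a x : Fin d → ℝ) :
    lapR (fun x => f (x + a)) x = lapR f (x + a) := by
  simp [lapR, pd_translate]

lemma ucp_local {d : ℕ} {D : Set (Fin d → ℝ)} (hD : IsOpen D) {U : (Fin d → ℝ) → ℝ} {M R : ℝ}
    (hU : ContDiffOn ℝ 2 U D) (hM : 0 ≤ M) (hlap : ∀ x ∈ D, |lapR U x| ≤ M * |U x|)
    {x0 : Fin d → ℝ} (hR : 0 < R) (hR1 : R ≤ 1) (hsub : Metric.closedBall x0 (2 * R) ⊆ D)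
    (hdens : ∀ δ : ℝ, 0 < δ → ∀ᶠ r in 𝓝[>] (0 : ℝ),
      volume (Metric.closedBall x0 r ∩ {x | U x ≠ 0}) ≤
      ENNReal.ofReal δ * volume (Metric.closedBall x0 r)) :
    ∀ x, nsq (x - x0) < R ^ 2 → U x = 0 := by
  let χ : ContDiffBump x0 := ⟨R, 2 * R, hR, by linarith⟩
  have hC : ContDiff ℝ 2 (fun x => χ x * U x) := by
    rw [contDiff_iff_contDiffAt]
    intro x
    by_cases hx : x ∈ D
    · exact χ.contDiffAt.mul (hU.contDiffAt (hD.mem_nhds hx))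
    · have : (fun x => χ x * U x) =ᶠ[𝓝 x] fun _ => 0 := by
        have h1 : (Metric.closedBall x0 (2 * R))ᶜ ∈ 𝓝 x :=
          Metric.isClosed_closedBall.isOpen_compl.mem_nhds fun h => hx (hsub h)
        filter_upwards [h1] with y hy
        rw [χ.zero_of_le_dist, zero_mul]
        simp only [mem_compl_iff, Metric.mem_closedBall, not_le] at hy
        exact hy.le
      exact contDiffAt_const.congr_of_eventuallyEq this
  have hball : ∀ y : Fin d → ℝ, nsq y < R ^ 2 → (fun x => χ x * U x) =ᶠ[𝓝 (y + x0)] U := by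
    intro y hy
    have : {z | nsq (z - x0) < R ^ 2} ∈ 𝓝 (y + x0) := by
      apply (isOpen_lt (continuous_nsq.comp (continuous_id.sub continuous_const))
        continuous_const).mem_nhds
      simpa using hy
    filter_upwards [this] with z hz
    rw [χ.one_of_mem_closedBall, one_mul]
    rw [Metric.mem_closedBall, dist_eq_norm]
    exact norm_le_of_sq hR.le (le_of_lt hz)
  have hmem : ∀ y : Fin d → ℝ, nsq y < R ^ 2 → y + x0 ∈ D := by
    intro y hy
    apply hsub
    rw [Metric.mem_closedBall, dist_eq_norm, add_sub_cancel_right]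
    linarith [norm_le_of_sq hR.le hy.le]
  have key := vanish_of_density (u := fun y => χ (y + x0) * U (y + x0)) (M := M) (R := R)
    (hC.comp (contDiff_id.add contDiff_const)) hM hR hR1 (by
      intro y hy
      rw [lapR_translate (fun x => χ x * U x) x0 y, lapR_congr (hball y hy),
        (hball y hy).eq_of_nhds]
      exact hlap _ (hmem y hy)) (by
      intro δ hδ
      filter_upwards [hdens δ hδ] with r hr
      have e1 : volume (Metric.closedBall (0 : Fin d → ℝ) r) = volume (Metric.closedBall x0 r) := by
        rw [← measure_preimage_add_right volume x0 (Metric.closedBall x0 r)]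
        congr 1; ext y; simp [dist_eq_norm]
      have e2 : volume (Metric.closedBall 0 r ∩ {x | U (x + x0) ≠ 0}) =
          volume (Metric.closedBall x0 r ∩ {x | U x ≠ 0}) := by
        rw [← measure_preimage_add_right volume x0 (Metric.closedBall x0 r ∩ _)]
        congr 1; ext y; simp [dist_eq_norm]
      rw [e1]
      refine le_trans (measure_mono ?_) (e2.trans_le hr)
      rintro y ⟨hy1, hy2⟩
      exact ⟨hy1, fun h => hy2 (by simp [h])⟩)
  intro x hx
  have h1 := key (x - x0) hx
  have h2 := (hball (x - x0) hx).eq_of_nhds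
  simp only [sub_add_cancel] at h1 h2
  rw [← h2, h1]

lemma nsq_lt_of_ball {d : ℕ} {R : ℝ} (hR : 0 < R) {x : Fin d → ℝ} (h : ‖x‖ < R / (d + 1)) :
    nsq x < R ^ 2 := by
  have hd : (0 : ℝ) < d + 1 := by positivity
  have h1 : nsq x ≤ d * ‖x‖ ^ 2 := by
    calc nsq x ≤ ∑ i : Fin d, ‖x‖ ^ 2 := by
          refine Finset.sum_le_sum fun i _ => ?_
          have := norm_le_pi_norm x i
          rw [← sq_abs (x i)]
          exact pow_le_pow_left₀ (abs_nonneg _) this 2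
      _ = _ := by simp
  rw [lt_div_iff₀ hd] at h
  have h2 : (‖x‖ * (d + 1)) ^ 2 < R ^ 2 := pow_lt_pow_left₀ h (by positivity) two_ne_zero
  nlinarith [sq_nonneg ‖x‖, mul_nonneg (sq_nonneg ‖x‖) (Nat.cast_nonneg (α := ℝ) d),
    mul_nonneg (sq_nonneg ‖x‖) (sq_nonneg (d : ℝ))]

lemma exists_R {d : ℕ} {D : Set (Fin d → ℝ)} (hD : IsOpen D) {x : Fin d → ℝ} (hx : x ∈ D) :
    ∃ R : ℝ, 0 < R ∧ R ≤ 1 ∧ Metric.closedBall x (4 * R) ⊆ D := by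
  obtain ⟨ε, hε, h⟩ := Metric.isOpen_iff.1 hD x hx
  refine ⟨min 1 (ε / 8), by positivity, min_le_left _ _, ?_⟩
  refine (Metric.closedBall_subset_ball ?_).trans h
  have := min_le_right 1 (ε / 8)
  linarith

lemma ucp {d : ℕ} {D D0 : Set (Fin d → ℝ)} (hD : IsOpen D) (hconn : IsConnected D)
    (hsub : D0 ⊆ D) (hmeas : MeasurableSet D0) (hpos : 0 < volume D0)
    {U : (Fin d → ℝ) → ℝ} {M : ℝ} (hU : ContDiffOn ℝ 2 U D) (hM : 0 ≤ M)
    (hlap : ∀ x ∈ D, |lapR U x| ≤ M * |U x|) (h0 : ∀ x ∈ D0, U x = 0) :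
    ∀ x ∈ D, U x = 0 := by
  -- density point
  obtain ⟨x0, hx0, hden⟩ : ∃ x0 ∈ D0, Tendsto (fun r => volume (D0 ∩ Metric.closedBall x0 r) /
      volume (Metric.closedBall x0 r)) (𝓝[>] 0) (𝓝 1) := by
    have h1 := Besicovitch.ae_tendsto_measure_inter_div (volume : Measure (Fin d → ℝ)) D0
    have h2 := ae_restrict_mem (μ := (volume : Measure (Fin d → ℝ))) hmeas
    have : (volume.restrict D0 : Measure (Fin d → ℝ)) ≠ 0 := by
      intro h; rw [Measure.restrict_eq_zero] at h; exact hpos.ne' h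
    have : NeBot (ae (volume.restrict D0)) := ae_neBot.2 this
    obtain ⟨x, hx⟩ := (h2.and h1).exists
    exact ⟨x, hx.1, hx.2⟩
  obtain ⟨R, hR, hR1, hRD⟩ := exists_R hD (hsub hx0)
  have hloc := ucp_local hD hU hM hlap hR hR1
    ((Metric.closedBall_subset_closedBall (by linarith)).trans hRD) (by
    intro δ hδ
    have hlt : ∀ᶠ r in 𝓝[>] (0 : ℝ), 1 - ENNReal.ofReal δ < volume (D0 ∩ Metric.closedBall x0 r) /
        volume (Metric.closedBall x0 r) := by
      apply hden.eventually_const_lt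
      exact ENNReal.sub_lt_self ENNReal.one_ne_top one_ne_zero (by simpa using hδ)
    filter_upwards [hlt, self_mem_nhdsWithin] with r hr hr0
    have hr0 : 0 < r := hr0
    have hB0 : volume (Metric.closedBall x0 r) ≠ 0 := (Metric.measure_closedBall_pos _ _ hr0).ne'
    have hBt : volume (Metric.closedBall x0 r) ≠ ⊤ := measure_closedBall_lt_top.ne
    have h3 : volume (Metric.closedBall x0 r ∩ D0) + volume (Metric.closedBall x0 r \ D0) =
      volume (Metric.closedBall x0 r) := measure_inter_add_sdiff _ hmeas
    have h4 : Metric.closedBall x0 r ∩ {x | U x ≠ 0} ⊆ Metric.closedBall x0 r \ D0 :=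
      fun y hy => ⟨hy.1, fun h => hy.2 (h0 y h)⟩
    refine (measure_mono h4).trans ?_
    rw [ENNReal.lt_div_iff_mul_lt (Or.inl hB0) (Or.inl hBt), inter_comm] at hr
    set B := volume (Metric.closedBall x0 r)
    set P := volume (Metric.closedBall x0 r ∩ D0)
    set Q := volume (Metric.closedBall x0 r \ D0)
    have hPt : P ≠ ⊤ := ne_top_of_le_ne_top hBt (measure_mono inter_subset_left)
    have h5 : B ≤ P + ENNReal.ofReal δ * B := by
      calc B = 1 * B := (one_mul _).symm
        _ ≤ ((1 - ENNReal.ofReal δ) + ENNReal.ofReal δ) * B := by gcongr; exact le_tsub_add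
        _ = (1 - ENNReal.ofReal δ) * B + ENNReal.ofReal δ * B := add_mul _ _ _
        _ ≤ _ := by gcongr
    rw [← h3] at h5
    exact (ENNReal.add_le_add_iff_left hPt).1 (by rw [h3] at h5 ⊢; exact h5))
  -- connectedness
  have hO : D ⊆ interior {x | U x = 0} := by
    apply hconn.isPreconnected.subset_of_closure_inter_subset isOpen_interior
    · refine ⟨x0, hsub hx0, ?_⟩
      rw [mem_interior_iff_mem_nhds]
      filter_upwards [Metric.ball_mem_nhds x0 (show 0 < R / (d + 1) by positivity)] with y hy
      exact hloc y (nsq_lt_of_ball hR (by rwa [← dist_eq_norm]))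
    · rintro x ⟨hxc, hxD⟩
      obtain ⟨R, hR, hR1, hRD⟩ := exists_R hD hxD
      have hR' : 0 < R / (d + 1) := by positivity
      have hle : R / (d + 1) ≤ R := div_le_self hR.le (by simp)
      obtain ⟨y, hyO, hy⟩ := Metric.mem_closure_iff.1 hxc _ hR'
      have hl := ucp_local hD hU hM hlap hR hR1 (x0 := y) (by
        refine (Metric.closedBall_subset_closedBall' ?_).trans hRD
        rw [dist_comm]; linarith) (by
        intro δ hδ
        rw [mem_interior_iff_mem_nhds, Metric.mem_nhds_iff] at hyO
        obtain ⟨ε, hε, hb⟩ := hyO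
        filter_upwards [Ioo_mem_nhdsGT hε] with r hr
        have : Metric.closedBall y r ∩ {x | U x ≠ 0} = ∅ := by
          ext z
          simp only [mem_inter_iff, mem_empty_iff_false, iff_false, not_and]
          intro hz h
          exact h (hb (Metric.closedBall_subset_ball hr.2 hz))
        rw [this]; simp)
      rw [mem_interior_iff_mem_nhds]
      filter_upwards [Metric.isOpen_ball.mem_nhds (show x ∈ Metric.ball y (R / (d + 1)) from hy)]
        with z hz
      exact hl z (nsq_lt_of_ball hR (by rwa [← dist_eq_norm]))
  intro x hx
  have h9 : x ∈ {x | U x = 0} := interior_subset (hO hx)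
  exact h9

section boundary

variable {E : Type*} [NormedAddCommGroup E] [NormedSpace ℝ E]

lemma first_exit {D : Set E} (hD : IsOpen D) {y e : E} (hy : y ∈ D) {T : ℝ}
    (h : ∃ t ∈ Icc 0 T, y + t • e ∉ D) :
    ∃ t0 ∈ Ioc 0 T, y + t0 • e ∈ frontier D ∧ ∀ t ∈ Ico 0 t0, y + t • e ∈ D := by
  have hγ : Continuous fun t : ℝ => y + t • e := by fun_prop
  have hc : IsCompact (Icc 0 T ∩ {t : ℝ | y + t • e ∉ D}) :=
    isCompact_Icc.inter_right (hD.isClosed_compl.preimage hγ)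
  obtain ⟨t, ht, htD⟩ := h
  obtain ⟨t0, ⟨ht0, ht0D⟩, hleast⟩ := hc.exists_isLeast ⟨t, ht, htD⟩
  have h0 : 0 < t0 := by
    rcases ht0.1.eq_or_lt with h | h
    · exfalso; apply ht0D; rw [← h]; simpa using hy
    · exact h
  have hin : ∀ t ∈ Ico 0 t0, y + t • e ∈ D := by
    intro s hs
    by_contra hsD
    exact absurd (hleast ⟨⟨hs.1, hs.2.le.trans ht0.2⟩, hsD⟩) (not_le.2 hs.2)
  refine ⟨t0, ⟨h0, ht0.2⟩, ?_, hin⟩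
  rw [hD.frontier_eq]
  refine ⟨?_, ht0D⟩
  refine map_mem_closure hγ (s := Ico 0 t0) ?_ hin
  rw [closure_Ico h0.ne]
  exact ⟨h0.le, le_rfl⟩

lemma hasDerivAt_line {p : E → ℝ} {y e : E} {t : ℝ} (h : DifferentiableAt ℝ p (y + t • e)) :
    HasDerivAt (fun s : ℝ => p (y + s • e)) (fderiv ℝ p (y + t • e) e) t := by
  have h1 : HasDerivAt (fun s : ℝ => y + s • e) e t := by
    simpa using ((hasDerivAt_id t).smul_const e).const_add y
  exact h.hasFDerivAt.comp_hasDerivAt t h1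

lemma push {D : Set E} (hD : IsOpen D) {p : E → ℝ} (hp : ∀ x ∈ D, DifferentiableAt ℝ p x)
    (hpc : ContinuousOn p (closure D)) (hp0 : ∀ x ∈ frontier D, p x = 0) {x e y : E} {ρ c T : ℝ}
    (hc : 0 < c) (hder : ∀ z ∈ D, z ∈ Metric.ball x ρ → c ≤ fderiv ℝ p z e)
    (hy : y ∈ D) (hpy : 0 ≤ p y) (hT : 0 ≤ T) (hball : ∀ t ∈ Icc 0 T, y + t • e ∈ Metric.ball x ρ) :
    y + T • e ∈ D ∧ c * T ≤ p (y + T • e) := by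
  have hγ : Continuous fun t : ℝ => y + t • e := by fun_prop
  have grow : ∀ s, 0 ≤ s → s ≤ T → (∀ t ∈ Ico 0 s, y + t • e ∈ D) → y + s • e ∈ closure D →
      c * s ≤ p (y + s • e) := by
    intro s hs hsT hin hcl
    have hin' : ∀ t ∈ Icc 0 s, y + t • e ∈ closure D := by
      intro t ht
      rcases ht.2.eq_or_lt with h | h
      · rw [h]; exact hcl
      · exact subset_closure (hin t ⟨ht.1, h⟩)
    have := (convex_Icc 0 s).mul_sub_le_image_sub_of_le_deriv (f := fun t => p (y + t • e)) (C := c)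
      (hpc.comp hγ.continuousOn hin') (by
        rw [interior_Icc]
        intro t ht
        exact (hasDerivAt_line (hp _ (hin t ⟨ht.1.le, ht.2⟩))).differentiableAt.differentiableWithinAt)
      (by
        rw [interior_Icc]
        intro t ht
        have htD := hin t ⟨ht.1.le, ht.2⟩
        rw [(hasDerivAt_line (hp _ htD)).deriv]
        exact hder _ htD (hball t ⟨ht.1.le, ht.2.le.trans hsT⟩)) 0 ⟨le_rfl, hs⟩ s ⟨hs, le_rfl⟩ hs
    simp only [sub_zero, zero_smul, add_zero] at this
    linarith
  have hall : ∀ t ∈ Icc 0 T, y + t • e ∈ D := by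
    by_contra hcon
    push Not at hcon
    obtain ⟨t0, ht0, hfr, hin⟩ := first_exit hD hy hcon
    have := grow t0 ht0.1.le ht0.2 hin (frontier_subset_closure hfr)
    rw [hp0 _ hfr] at this
    nlinarith [ht0.1]
  have hTD := hall T ⟨hT, le_rfl⟩
  exact ⟨hTD, grow T hT le_rfl (fun t ht => hall t ⟨ht.1, ht.2.le⟩) (subset_closure hTD)⟩

lemma grad_zero_aux {D : Set E} (hD : IsOpen D) {p : E → ℝ} (hp : ∀ x ∈ D, DifferentiableAt ℝ p x)
    (hpc : ContinuousOn p (closure D)) (hp0 : ∀ x ∈ frontier D, p x = 0) {x : E}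
    (hx : x ∈ frontier D) (hd : HasFDerivWithinAt p (0 : E →L[ℝ] ℝ) (closure D) x)
    {L : E →L[ℝ] ℝ} (hL : Tendsto (fderiv ℝ p) (𝓝[D] x) (𝓝 L)) (e : E) : L e ≤ 0 := by
  by_contra hpos
  push Not at hpos
  set c := L e / 2 with hcdef
  have hc : 0 < c := by positivity
  have hev1 : ∀ᶠ z in 𝓝[D] x, c ≤ fderiv ℝ p z e := by
    have h1 : Tendsto (fun z => fderiv ℝ p z e) (𝓝[D] x) (𝓝 (L e)) :=
      ((ContinuousLinearMap.apply ℝ ℝ e).continuous.tendsto L).comp hL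
    exact (h1.eventually_const_lt (show c < L e by rw [hcdef]; linarith)).mono fun z hz => hz.le
  set ε := c / (4 * (‖e‖ + 1)) with hε
  have hε0 : 0 < ε := by positivity
  have hev2 : ∀ᶠ z in 𝓝[closure D] x, |p z| ≤ ε * ‖z - x‖ := by
    have := hd.isLittleO.def hε0
    simpa [hp0 x hx] using this
  rw [eventually_nhdsWithin_iff, Metric.eventually_nhds_iff_ball] at hev1 hev2
  obtain ⟨ρ1, hρ1, h1⟩ := hev1
  obtain ⟨ρ2, hρ2, h2⟩ := hev2
  set ρ := min ρ1 ρ2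
  have hρ : 0 < ρ := lt_min hρ1 hρ2
  have hρ1' : ρ ≤ ρ1 := min_le_left _ _
  have hρ2' : ρ ≤ ρ2 := min_le_right _ _
  set T := ρ / (2 * (‖e‖ + 1)) with hT
  have hT0 : 0 < T := by positivity
  have hTe : T * (‖e‖ + 1) = ρ / 2 := by rw [hT]; field_simp
  have hTn : 0 ≤ T * ‖e‖ := by positivity
  obtain ⟨y, hyD, hyx⟩ := Metric.mem_closure_iff.1 (frontier_subset_closure hx) T hT0
  rw [dist_comm, dist_eq_norm] at hyx
  have hdist : ∀ t ∈ Icc 0 T, ∀ e' : E, ‖e'‖ = ‖e‖ → ‖y + t • e' - x‖ ≤ T + T * ‖e‖ := by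
    intro t ht e' he'
    calc ‖y + t • e' - x‖ = ‖(y - x) + t • e'‖ := by congr 1; abel
      _ ≤ ‖y - x‖ + ‖t • e'‖ := norm_add_le _ _
      _ ≤ T + T * ‖e‖ := by
        rw [norm_smul, he', Real.norm_of_nonneg ht.1]
        gcongr
        exact ht.2
  have hdist' : ∀ t ∈ Icc 0 T, ∀ e' : E, ‖e'‖ = ‖e‖ → y + t • e' ∈ Metric.ball x ρ := by
    intro t ht e' he'
    rw [Metric.mem_ball, dist_eq_norm]
    have := hdist t ht e' he'
    linarith
  have hfin : ∀ e' : E, ‖e'‖ = ‖e‖ → y + T • e' ∈ D → c * T ≤ |p (y + T • e')| → False := by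
    intro e' he' hm hle
    have h3 := h2 (y + T • e') (Metric.ball_subset_ball hρ2' (hdist' T ⟨hT0.le, le_rfl⟩ e' he'))
      (subset_closure hm)
    have h4 := hdist T ⟨hT0.le, le_rfl⟩ e' he'
    have h5 : |p (y + T • e')| ≤ ε * (T + T * ‖e‖) := h3.trans (by gcongr)
    have h6 : ε * (T + T * ‖e‖) = c * T / 4 := by rw [hε]; field_simp; ring
    have : 0 < c * T := by positivity
    linarith
  rcases le_total 0 (p y) with hpy | hpy
  · obtain ⟨ha, hb⟩ := push hD hp hpc hp0 (x := x) (e := e) (ρ := ρ) hc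
      (fun z hz hzb => h1 z (Metric.ball_subset_ball hρ1' hzb) hz) hyD hpy hT0.le
      (fun t ht => hdist' t ht e rfl)
    exact hfin e rfl ha (hb.trans (le_abs_self _))
  · obtain ⟨ha, hb⟩ := push hD (p := fun z => - p z) (fun z hz => (hp z hz).neg) hpc.neg
      (fun z hz => by simp [hp0 z hz]) (x := x) (e := -e) (ρ := ρ) hc
      (fun z hz hzb => by
        rw [fderiv_fun_neg]
        simpa using h1 z (Metric.ball_subset_ball hρ1' hzb) hz) hyD (by simpa using hpy) hT0.le
      (fun t ht => hdist' t ht (-e) (norm_neg e))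
    exact hfin (-e) (norm_neg e) ha (hb.trans (neg_le_abs _))

lemma grad_zero {D : Set E} (hD : IsOpen D) {p : E → ℝ} (hp : ∀ x ∈ D, DifferentiableAt ℝ p x)
    (hpc : ContinuousOn p (closure D)) (hp0 : ∀ x ∈ frontier D, p x = 0) {x : E}
    (hx : x ∈ frontier D) (hd : HasFDerivWithinAt p (0 : E →L[ℝ] ℝ) (closure D) x)
    {L : E →L[ℝ] ℝ} (hL : Tendsto (fderiv ℝ p) (𝓝[D] x) (𝓝 L)) : L = 0 := by
  ext e
  have h1 := grad_zero_aux hD hp hpc hp0 hx hd hL e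
  have h2 := grad_zero_aux hD hp hpc hp0 hx hd hL (-e)
  rw [map_neg] at h2
  simp only [zero_apply]
  linarith

lemma reg_step {F : Type*} [NormedAddCommGroup F] [NormedSpace ℝ F] {D : Set E} (hD : IsOpen D)
    {f : E → F} {n : ℕ} {x : E} (hx : x ∈ closure D)
    (h : ContDiffWithinAt ℝ (n + 1) f (closure D) x) :
    ∃ f' : E → E →L[ℝ] F, HasFDerivWithinAt f (f' x) (closure D) x ∧
      (∀ᶠ y in 𝓝[D] x, fderiv ℝ f =ᶠ[𝓝 y] f') ∧ ContDiffWithinAt ℝ n f' (closure D) x := by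
  rw [contDiffWithinAt_succ_iff_hasFDerivWithinAt' (by simp)] at h
  obtain ⟨u, hu, -, -, f', hf', hc⟩ := h
  rw [insert_eq_of_mem hx] at hu
  refine ⟨f', hf' x (mem_of_mem_nhdsWithin hx hu), ?_, hc⟩
  obtain ⟨V, hV, hxV, hVu⟩ := mem_nhdsWithin.1 hu
  have : V ∩ D ∈ 𝓝[D] x := by
    rw [inter_comm]; exact inter_mem_nhdsWithin D (hV.mem_nhds hxV)
  filter_upwards [this] with y hy
  filter_upwards [(hV.inter hD).mem_nhds hy] with z hz
  have h1 := hf' z (hVu ⟨hz.1, subset_closure hz.2⟩)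
  exact (h1.hasFDerivAt (mem_of_superset (hD.mem_nhds hz.2) subset_closure)).fderiv

lemma reg2 {F : Type*} [NormedAddCommGroup F] [NormedSpace ℝ F] {D : Set E} (hD : IsOpen D)
    {f : E → F} {x : E} (hx : x ∈ closure D) (h : ContDiffWithinAt ℝ 2 f (closure D) x) :
    ∃ L, HasFDerivWithinAt f L (closure D) x ∧ Tendsto (fderiv ℝ f) (𝓝[D] x) (𝓝 L) ∧
      ∃ L2, Tendsto (fderiv ℝ (fderiv ℝ f)) (𝓝[D] x) (𝓝 L2) := by
  obtain ⟨f', h1, h2, h3⟩ := reg_step hD (n := 1) hx (by norm_num; exact h)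
  obtain ⟨f'', h4, h5, h6⟩ := reg_step hD (n := 0) hx (by norm_num; norm_num at h3; exact h3)
  refine ⟨f' x, h1, ?_, f'' x, ?_⟩
  · have := (h3.continuousWithinAt.mono subset_closure).tendsto
    exact this.congr' (h2.mono fun y hy => hy.eq_of_nhds.symm)
  · have := (h6.continuousWithinAt.mono subset_closure).tendsto
    refine this.congr' ?_
    filter_upwards [h2, h5] with y hy hy2
    rw [hy.fderiv_eq, hy2.eq_of_nhds]

lemma bdd_of_limits {F : Type*} [NormedAddCommGroup F] {D : Set E}
    (hK : IsCompact (closure D)) {g : E → F}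
    (h : ∀ x ∈ closure D, ∃ L, Tendsto g (𝓝[D] x) (𝓝 L)) : ∃ C, ∀ x ∈ D, ‖g x‖ ≤ C := by
  have : ∃ C, ∀ x ∈ closure D ∩ D, ‖g x‖ ≤ C := by
    refine hK.induction_on (p := fun s => ∃ C, ∀ x ∈ s ∩ D, ‖g x‖ ≤ C) ⟨0, by simp⟩ ?_ ?_ ?_
    · rintro s t hst ⟨C, hC⟩
      exact ⟨C, fun x hx => hC x ⟨hst hx.1, hx.2⟩⟩
    · rintro s t ⟨C, hC⟩ ⟨C', hC'⟩
      refine ⟨max C C', ?_⟩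
      rintro x ⟨hx | hx, hxD⟩
      · exact (hC x ⟨hx, hxD⟩).trans (le_max_left _ _)
      · exact (hC' x ⟨hx, hxD⟩).trans (le_max_right _ _)
    · intro x hx
      obtain ⟨L, hL⟩ := h x hx
      have h1 : ∀ᶠ y in 𝓝[D] x, ‖g y‖ < ‖L‖ + 1 :=
        hL.norm.eventually_lt_const (by linarith)
      rw [eventually_nhdsWithin_iff] at h1
      refine ⟨_, mem_nhdsWithin_of_mem_nhds h1, ‖L‖ + 1, ?_⟩
      rintro y ⟨hy, hyD⟩
      exact (hy hyD).le
  obtain ⟨C, hC⟩ := this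
  exact ⟨C, fun x hx => hC x ⟨subset_closure hx, hx⟩⟩

lemma continuous_ind {D : Set E} (hD : IsOpen D) {G : E → ℝ} (hG : ContinuousOn G D)
    (h0 : ∀ x ∈ frontier D, Tendsto G (𝓝[D] x) (𝓝 0)) : Continuous (D.indicator G) := by
  rw [continuous_iff_continuousAt]
  intro x
  by_cases hx : x ∈ D
  · have : D.indicator G =ᶠ[𝓝 x] G := by
      filter_upwards [hD.mem_nhds hx] with y hy
      exact indicator_of_mem hy G
    exact (hG.continuousAt (hD.mem_nhds hx)).congr this.symm
  · rw [ContinuousAt, indicator_of_notMem hx]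
    by_cases hc : x ∈ closure D
    · have h1 := h0 x (by rw [hD.frontier_eq]; exact ⟨hc, hx⟩)
      rw [← nhdsWithin_univ, ← union_compl_self D, nhdsWithin_union]
      refine Tendsto.sup ?_ ?_
      · exact h1.congr' (eventually_of_mem self_mem_nhdsWithin fun y hy => (indicator_of_mem hy G).symm)
      · exact tendsto_const_nhds.congr'
          (eventually_of_mem self_mem_nhdsWithin fun y hy => (indicator_of_notMem hy G).symm)
    · refine tendsto_const_nhds.congr' ?_
      filter_upwards [isClosed_closure.isOpen_compl.mem_nhds hc] with y hy
      exact (indicator_of_notMem (fun h => hy (subset_closure h)) G).symm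

lemma lip_aux {D : Set E} (hD : IsOpen D) {F : E → ℝ} (hF : Continuous F)
    (h0 : ∀ x, x ∉ D → F x = 0) (hd : ∀ x ∈ D, DifferentiableAt ℝ F x) {M : ℝ} 
    (hM : ∀ x ∈ D, ‖fderiv ℝ F x‖ ≤ M) {x y : E} (hx : x ∈ D) (hy : y ∉ D) :
    |F x| ≤ M * ‖y - x‖ := by
  have hM0 : 0 ≤ M := (norm_nonneg _).trans (hM x hx)
  obtain ⟨t0, ht0, hfr, hin⟩ := first_exit hD (e := y - x) hx (T := 1) ⟨1, by simp, by simpa using hy⟩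
  have hγ : Continuous fun t : ℝ => x + t • (y - x) := by fun_prop
  have := norm_image_sub_le_of_norm_deriv_right_le_segment (f := fun t : ℝ => F (x + t • (y - x)))
    (a := 0) (b := t0) (C := M * ‖y - x‖) (hF.comp hγ).continuousOn
    (fun t ht => (hasDerivAt_line (hd _ (hin t ht))).hasDerivWithinAt)
    (fun t ht => (ContinuousLinearMap.le_opNorm _ _).trans (by gcongr; exact hM _ (hin t ht)))
    t0 ⟨ht0.1.le, le_rfl⟩
  rw [hD.frontier_eq] at hfr
  simp only [zero_smul, add_zero, sub_zero, h0 _ hfr.2, zero_sub, norm_neg] at this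
  refine this.trans ?_
  have : 0 ≤ M * ‖y - x‖ := by positivity
  nlinarith [ht0.2]

lemma lip_main {D : Set E} (hD : IsOpen D) {F : E → ℝ} (hF : Continuous F)
    (h0 : ∀ x, x ∉ D → F x = 0) (hd : ∀ x ∈ D, DifferentiableAt ℝ F x) {M : ℝ} (hM0 : 0 ≤ M)
    (hM : ∀ x ∈ D, ‖fderiv ℝ F x‖ ≤ M) : LipschitzWith M.toNNReal F := by
  apply LipschitzWith.of_dist_le_mul
  intro x y
  rw [Real.coe_toNNReal _ hM0, dist_eq_norm, dist_eq_norm]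
  by_cases hx : x ∈ D
  · by_cases hseg : segment ℝ x y ⊆ D
    · rw [norm_sub_rev, norm_sub_rev x y]
      exact (convex_segment x y).norm_image_sub_le_of_norm_fderiv_le (𝕜 := ℝ)
        (fun z hz => hd z (hseg hz)) (fun z hz => hM z (hseg hz)) (left_mem_segment ℝ x y)
        (right_mem_segment ℝ x y)
    · rw [not_subset] at hseg
      obtain ⟨z, hz, hzD⟩ := hseg
      have hadd := dist_add_dist_of_mem_segment hz
      simp only [dist_eq_norm] at hadd
      have h1 := lip_aux hD hF h0 hd hM hx hzD
      have h2 : |F y| ≤ M * ‖z - y‖ := by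
        by_cases hy : y ∈ D
        · exact lip_aux hD hF h0 hd hM hy hzD
        · rw [h0 y hy, abs_zero]; positivity
      calc ‖F x - F y‖ ≤ |F x| + |F y| := abs_sub _ _
        _ ≤ M * ‖z - x‖ + M * ‖z - y‖ := add_le_add h1 h2
        _ = M * ‖x - y‖ := by rw [← hadd, norm_sub_rev z x]; ring
  · rw [h0 x hx, zero_sub, norm_neg, Real.norm_eq_abs]
    by_cases hy : y ∈ D
    · exact lip_aux hD hF h0 hd hM hy hx
    · rw [h0 y hy, abs_zero]; positivity

end boundary

lemma int_pd_zero {d : ℕ} {D : Set (Fin d → ℝ)} (hD : IsOpen D) (hb : Bornology.IsBounded D)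
    {F : (Fin d → ℝ) → ℝ} (hF : Continuous F)
    (h0 : ∀ x, x ∉ D → F x = 0) (hd : ∀ x ∈ D, DifferentiableAt ℝ F x) {M : ℝ}
    (hM : ∀ x ∈ D, ‖fderiv ℝ F x‖ ≤ M) (i : Fin d) : ∫ x in D, pd i F x = 0 := by
  have hM' : ∀ x ∈ D, ‖fderiv ℝ F x‖ ≤ max M 0 := fun x hx => (hM x hx).trans (le_max_left _ _)
  have hlip := lip_main hD hF h0 hd (le_max_right _ _) hM'
  have hlip2 : LipschitzWith (1 * (max M 0).toNNReal) (fun x => |F x|) :=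
    LipschitzWith.comp lipschitzWith_one_norm hlip
  have hcs : HasCompactSupport F := by
    apply HasCompactSupport.intro hb.isCompact_closure
    intro x hx
    exact h0 x fun h => hx (subset_closure h)
  have hone : LipschitzWith 0 (fun _ : Fin d → ℝ => (1 : ℝ)) := LipschitzWith.const 1
  have key := LipschitzWith.integral_lineDeriv_mul_eq (μ := (volume : Measure (Fin d → ℝ)))
    hone hlip hcs (-(Pi.single i 1))
  have e1 : ∀ x : Fin d → ℝ, lineDeriv ℝ (fun _ : Fin d → ℝ => (1 : ℝ)) x (-(Pi.single i 1)) = 0 := by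
    intro x; simp [lineDeriv]
  simp only [e1, zero_mul, integral_zero, neg_neg, mul_one] at key
  rw [← integral_indicator hD.measurableSet, key]
  apply integral_congr_ae
  filter_upwards [hlip.ae_lineDifferentiableAt (μ := volume) (Pi.single i 1),
    hlip2.ae_lineDifferentiableAt (μ := volume) (Pi.single i 1)] with x hx1 hx2
  by_cases hx : x ∈ D
  · rw [indicator_of_mem hx, (hd x hx).lineDeriv_eq_fderiv]; rfl
  · rw [indicator_of_notMem hx]
    have ha : HasDerivAt (fun t : ℝ => F (x + t • (Pi.single i 1 : Fin d → ℝ))) (lineDeriv ℝ F x (Pi.single i 1)) 0 :=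
      hx1.hasLineDerivAt
    have hb : HasDerivAt (fun t : ℝ => |F (x + t • (Pi.single i 1 : Fin d → ℝ))|)
      (lineDeriv ℝ (fun x => |F x|) x (Pi.single i 1)) 0 := hx2.hasLineDerivAt
    have hmin : IsLocalMin (fun t : ℝ => |F (x + t • (Pi.single i 1 : Fin d → ℝ))|) 0 := by
      refine Eventually.of_forall fun t => ?_
      simp [h0 x hx]
    have hb0 := hmin.hasDerivAt_eq_zero hb
    rw [hb0] at hb
    have hc : HasDerivAt (fun t : ℝ => F (x + t • (Pi.single i 1 : Fin d → ℝ))) 0 0 := by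
      rw [hasDerivAt_iff_isLittleO] at hb ⊢
      simp only [zero_smul, add_zero, h0 x hx, abs_zero, sub_zero, smul_zero] at hb ⊢
      exact (Asymptotics.isLittleO_norm_left (f' := fun t : ℝ => F (x + t • (Pi.single i 1 : Fin d → ℝ)))).1 hb
    exact (ha.unique hc).symm

lemma flux {d : ℕ} {D : Set (Fin d → ℝ)} (hD : IsOpen D) (hb : Bornology.IsBounded D)
    {G : (Fin d → ℝ) → ℝ} (hd : ∀ x ∈ D, DifferentiableAt ℝ G x)
    (h0 : ∀ x ∈ frontier D, Tendsto G (𝓝[D] x) (𝓝 0))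
    (hl : ∀ x ∈ closure D, ∃ L, Tendsto (fderiv ℝ G) (𝓝[D] x) (𝓝 L)) (i : Fin d) :
    IntegrableOn (pd i G) D ∧ ∫ x in D, pd i G x = 0 := by
  obtain ⟨C, hC⟩ := bdd_of_limits hb.isCompact_closure hl
  have heq : ∀ x ∈ D, D.indicator G =ᶠ[𝓝 x] G := by
    intro x hx
    filter_upwards [hD.mem_nhds hx] with y hy
    exact indicator_of_mem hy G
  constructor
  · refine Measure.integrableOn_of_bounded (M := C * ‖(Pi.single i 1 : Fin d → ℝ)‖)
      hb.measure_lt_top.ne ?_ ?_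
    · exact (measurable_fderiv_apply_const ℝ G (Pi.single i 1)).aestronglyMeasurable
    · refine (ae_restrict_iff' hD.measurableSet).2 (Eventually.of_forall fun x hx => ?_)
      refine (ContinuousLinearMap.le_opNorm _ _).trans ?_
      gcongr
      exact hC x hx
  · have := int_pd_zero hD hb (F := D.indicator G)
      (continuous_ind hD (fun x hx => (hd x hx).continuousAt.continuousWithinAt) h0)
      (fun x hx => indicator_of_notMem hx G)
      (fun x hx => (heq x hx).differentiableAt_iff.2 (hd x hx)) (M := C)
      (fun x hx => by rw [(heq x hx).fderiv_eq]; exact hC x hx) i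
    rw [← this]
    apply setIntegral_congr_fun hD.measurableSet
    intro x hx
    simp only [pd, (heq x hx).fderiv_eq]

/-- zero Cauchy data -/
def ZeroCauchy {d : ℕ} (D : Set (Fin d → ℝ)) (p : (Fin d → ℝ) → ℝ) : Prop :=
  ∀ x ∈ frontier D, p x = 0 ∧ HasFDerivWithinAt p (0 : (Fin d → ℝ) →L[ℝ] ℝ) (closure D) x

section green

variable {d : ℕ} {D : Set (Fin d → ℝ)} {f p : (Fin d → ℝ) → ℝ}

lemma cda (hD : IsOpen D) (hf : ContDiffOn ℝ 2 f (closure D)) {x : Fin d → ℝ} (hx : x ∈ D) :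
    ContDiffAt ℝ 2 f x :=
  hf.contDiffAt (mem_of_superset (hD.mem_nhds hx) subset_closure)

lemma hfd_pd (hD : IsOpen D) (hf : ContDiffOn ℝ 2 f (closure D)) {x : Fin d → ℝ} (hx : x ∈ D)
    (i : Fin d) : HasFDerivAt (pd i f)
      ((ContinuousLinearMap.apply ℝ ℝ (Pi.single i 1 : Fin d → ℝ)).comp
        (fderiv ℝ (fderiv ℝ f) x)) x := by
  have h1 : DifferentiableAt ℝ (fderiv ℝ f) x :=
    ((cda hD hf hx).fderiv_right (m := 1) (by norm_num)).differentiableAt (by norm_num)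
  exact (ContinuousLinearMap.apply ℝ ℝ (Pi.single i 1 : Fin d → ℝ)).hasFDerivAt.comp x
    h1.hasFDerivAt

lemma green (hD : IsOpen D) (hb : Bornology.IsBounded D) (hf : ContDiffOn ℝ 2 f (closure D))
    (hp : ContDiffOn ℝ 2 p (closure D)) (hz : ZeroCauchy D p) :
    IntegrableOn (fun x => f x * lapR p x - p x * lapR f x) D ∧
      ∫ x in D, (f x * lapR p x - p x * lapR f x) = 0 := by
  set A : Fin d → ((Fin d → ℝ) →L[ℝ] ℝ) →L[ℝ] ℝ :=
    fun i => ContinuousLinearMap.apply ℝ ℝ (Pi.single i 1 : Fin d → ℝ) with hA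
  have hG : ∀ i, ∀ x ∈ D, HasFDerivAt (fun x => f x * pd i p x - p x * pd i f x)
      ((f x • (A i).comp (fderiv ℝ (fderiv ℝ p) x) + A i (fderiv ℝ p x) • fderiv ℝ f x) -
       (p x • (A i).comp (fderiv ℝ (fderiv ℝ f) x) + A i (fderiv ℝ f x) • fderiv ℝ p x)) x := by
    intro i x hx
    have h1 := ((cda hD hf hx).differentiableAt (by norm_num)).hasFDerivAt
    have h2 := ((cda hD hp hx).differentiableAt (by norm_num)).hasFDerivAt
    exact (h1.mul (hfd_pd hD hp hx i)).sub (h2.mul (hfd_pd hD hf hx i))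
  have hlim : ∀ {g : (Fin d → ℝ) → ℝ}, ContDiffOn ℝ 2 g (closure D) → ∀ x ∈ closure D,
      Tendsto g (𝓝[D] x) (𝓝 (g x)) := fun hg x hx =>
    ((hg.continuousOn x hx).mono subset_closure).tendsto
  have hcompL : ∀ i {h : (Fin d → ℝ) → (Fin d → ℝ) →L[ℝ] (Fin d → ℝ) →L[ℝ] ℝ} {L} {l : Filter (Fin d → ℝ)},
      Tendsto h l (𝓝 L) → Tendsto (fun x => (A i).comp (h x)) l (𝓝 ((A i).comp L)) := by
    intro i h L l hh
    have hc : Continuous fun B : (Fin d → ℝ) →L[ℝ] (Fin d → ℝ) →L[ℝ] ℝ => (A i).comp B := by fun_prop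
    exact (hc.tendsto L).comp hh
  have hfl : ∀ i, IntegrableOn (pd i (fun x => f x * pd i p x - p x * pd i f x)) D ∧
      ∫ x in D, pd i (fun x => f x * pd i p x - p x * pd i f x) x = 0 := by
    intro i
    apply flux hD hb
    · exact fun x hx => (hG i x hx).differentiableAt
    · intro x hx
      have hxc := frontier_subset_closure hx
      obtain ⟨Lf, -, hLf, -⟩ := reg2 hD hxc (hf x hxc)
      obtain ⟨Lp, -, hLp, -⟩ := reg2 hD hxc (hp x hxc)
      have hLp0 : Lp = 0 := grad_zero hD (fun y hy => (cda hD hp hy).differentiableAt (by norm_num))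
        hp.continuousOn (fun y hy => (hz y hy).1) hx (hz x hx).2 hLp
      have h1 := ((hlim hf x hxc).mul (((A i).continuous.tendsto Lp).comp hLp)).sub
        ((hlim hp x hxc).mul (((A i).continuous.tendsto Lf).comp hLf))
      rw [hLp0, (hz x hx).1] at h1
      simp only [map_zero, mul_zero, zero_mul, sub_zero] at h1
      exact h1
    · intro x hxc
      obtain ⟨Lf, -, hLf, Lf2, hLf2⟩ := reg2 hD hxc (hf x hxc)
      obtain ⟨Lp, -, hLp, Lp2, hLp2⟩ := reg2 hD hxc (hp x hxc)
      have ht := (((hlim hf x hxc).smul (hcompL i hLp2)).add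
        ((((A i).continuous.tendsto Lp).comp hLp).smul hLf)).sub
        (((hlim hp x hxc).smul (hcompL i hLf2)).add
        ((((A i).continuous.tendsto Lf).comp hLf).smul hLp))
      exact ⟨_, ht.congr' (eventually_of_mem self_mem_nhdsWithin
        fun y hy => (hG i y hy).fderiv.symm)⟩
  have heq : ∀ x ∈ D, f x * lapR p x - p x * lapR f x =
      ∑ i, pd i (fun x => f x * pd i p x - p x * pd i f x) x := by
    intro x hx
    unfold lapR
    rw [Finset.mul_sum, Finset.mul_sum, ← Finset.sum_sub_distrib]
    refine Finset.sum_congr rfl fun i _ => ?_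
    conv_rhs => rw [pd, (hG i x hx).fderiv]
    have e1 : pd i (pd i p) x = A i (fderiv ℝ (fderiv ℝ p) x (Pi.single i 1)) := by
      conv_lhs => rw [pd, (hfd_pd hD hp hx i).fderiv]
      rfl
    have e2 : pd i (pd i f) x = A i (fderiv ℝ (fderiv ℝ f) x (Pi.single i 1)) := by
      conv_lhs => rw [pd, (hfd_pd hD hf hx i).fderiv]
      rfl
    rw [e1, e2]
    simp only [hA, sub_apply, add_apply,
      smul_apply, ContinuousLinearMap.comp_apply,
      ContinuousLinearMap.apply_apply, smul_eq_mul]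
    ring
  have hi : IntegrableOn (fun x => ∑ i, pd i (fun x => f x * pd i p x - p x * pd i f x) x) D :=
    integrable_finsetSum _ fun i _ => (hfl i).1
  constructor
  · exact hi.congr_fun (fun x hx => (heq x hx).symm) hD.measurableSet
  · rw [setIntegral_congr_fun hD.measurableSet heq, integral_finsetSum _ fun i _ => (hfl i).1]
    exact Finset.sum_eq_zero fun i _ => (hfl i).2

end green

/-- real exponential -/
noncomputable def ex {d : ℕ} (ξ x : Fin d → ℝ) : ℝ := Real.exp (∑ i, ξ i * x i)

lemma pd_ex {d : ℕ} (ξ : Fin d → ℝ) (i : Fin d) : pd i (ex ξ) = fun x => ξ i * ex ξ x := by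
  ext x
  have h1 : HasFDerivAt (fun x : Fin d → ℝ => ∑ i, ξ i * x i)
      (∑ i, ξ i • ContinuousLinearMap.proj (R := ℝ) (φ := fun _ : Fin d => ℝ) i) x := by
    apply HasFDerivAt.fun_sum
    intro j _
    exact (hasFDerivAt_apply (𝕜 := ℝ) (F' := fun _ : Fin d => ℝ) j x).const_mul (ξ j)
  have h2 : HasFDerivAt (ex ξ) _ x := h1.exp
  rw [pd, h2.fderiv]
  simp [ex, Pi.single_apply, mul_comm]

lemma contDiff_ex {d : ℕ} (ξ : Fin d → ℝ) : ContDiff ℝ 2 (ex ξ) := by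
  unfold ex; fun_prop

lemma lapR_ex {d : ℕ} (ξ x : Fin d → ℝ) : lapR (ex ξ) x = nsq ξ * ex ξ x := by
  unfold lapR nsq
  rw [Finset.sum_mul]
  refine Finset.sum_congr rfl fun i _ => ?_
  rw [pd_ex]
  have h := pd_mul i (f := fun _ => ξ i) (g := ex ξ) (x := x) (differentiableAt_const _)
    ((contDiff_ex ξ).differentiable (by norm_num) x)
  rw [h, pd_ex]
  simp [pd]; ring

lemma helm_zero {d : ℕ} {D : Set (Fin d → ℝ)} (hD : IsOpen D) (hb : Bornology.IsBounded D)
    {p : (Fin d → ℝ) → ℝ} (hp : ContDiffOn ℝ 2 p (closure D)) (hz : ZeroCauchy D p)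
    {k : ℝ} (hk : 0 < k) (heq : ∀ x ∈ D, lapR p x = - k ^ 2 * p x) : ∀ x ∈ D, p x = 0 := by
  have hKc : IsCompact (closure D) := hb.isCompact_closure
  have hpi : ∀ {g : (Fin d → ℝ) → ℝ}, ContinuousOn g (closure D) → IntegrableOn g D := fun hg =>
    (hg.integrableOn_compact hKc).mono_set subset_closure
  have hpm : ∀ {g : (Fin d → ℝ) → ℝ}, Continuous g → IntegrableOn (fun x => p x * g x) D := fun hg =>
    hpi (hp.continuousOn.mul hg.continuousOn)
  have hexp : ∀ ξ, ∫ x in D, p x * ex ξ x = 0 := by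
    intro ξ
    have h1 := (green hD hb (contDiff_ex ξ).contDiffOn hp hz).2
    have h2 : ∫ x in D, (ex ξ x * lapR p x - p x * lapR (ex ξ) x) =
        ∫ x in D, -(k ^ 2 + nsq ξ) * (p x * ex ξ x) := by
      apply setIntegral_congr_fun hD.measurableSet
      intro x hx
      simp only [heq x hx, lapR_ex]
      ring
    rw [h2, integral_const_mul] at h1
    have h3 : 0 < k ^ 2 + nsq ξ := by have := nsq_nonneg ξ; positivity
    rcases mul_eq_zero.1 h1 with h | h
    · linarith
    · exact h
  have : CompactSpace (closure D) := isCompact_iff_compactSpace.1 hKc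
  let eK : (Fin d → ℝ) → C(closure D, ℝ) := fun ξ =>
    ⟨fun x => ex ξ x, (contDiff_ex ξ).continuous.comp continuous_subtype_val⟩
  let S : Submonoid C(closure D, ℝ) :=
    { carrier := range eK
      one_mem' := ⟨0, by ext x; simp [eK, ex]⟩
      mul_mem' := by
        rintro _ _ ⟨ξ, rfl⟩ ⟨η, rfl⟩
        refine ⟨ξ + η, ?_⟩
        ext x
        simp [eK, ex, ← Real.exp_add, add_mul, Finset.sum_add_distrib] }
  have hspan : ∀ g ∈ Algebra.adjoin ℝ (S : Set C(closure D, ℝ)),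
      ∃ G : (Fin d → ℝ) → ℝ, Continuous G ∧ (∀ x : closure D, G x = g x) ∧
        ∫ x in D, p x * G x = 0 := by
    intro g hg
    have hg' : g ∈ Submodule.span ℝ (S : Set C(closure D, ℝ)) := by
      rw [← Subalgebra.mem_toSubmodule, Algebra.adjoin_eq_span, Submonoid.closure_eq] at hg
      exact hg
    clear hg
    induction hg' using Submodule.span_induction with
    | mem g h =>
      obtain ⟨ξ, rfl⟩ := h
      exact ⟨ex ξ, (contDiff_ex ξ).continuous, fun x => rfl, hexp ξ⟩
    | zero => exact ⟨0, continuous_const, fun x => rfl, by simp⟩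
    | add g h _ _ ih1 ih2 =>
      obtain ⟨G, hGc, hG, hGi⟩ := ih1
      obtain ⟨H, hHc, hH, hHi⟩ := ih2
      refine ⟨fun x => G x + H x, hGc.add hHc, fun x => by simp [hG, hH], ?_⟩
      simp only [mul_add]
      rw [integral_add (hpm hGc)
        (hpm hHc), hGi, hHi, add_zero]
    | smul a g _ ih =>
      obtain ⟨G, hGc, hG, hGi⟩ := ih
      refine ⟨fun x => a * G x, continuous_const.mul hGc, fun x => by simp [hG], ?_⟩
      have : ∀ x, p x * (a * G x) = a * (p x * G x) := fun x => by ring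
      simp only [this]
      rw [integral_const_mul, hGi, mul_zero]
  have hsep : (Algebra.adjoin ℝ (S : Set C(closure D, ℝ))).SeparatesPoints := by
    intro x y hxy
    have h1 : (x : Fin d → ℝ) ≠ y := fun h => hxy (Subtype.ext h)
    obtain ⟨i, hi⟩ := Function.ne_iff.1 h1
    refine ⟨_, ⟨eK (Pi.single i 1), Algebra.subset_adjoin ⟨_, rfl⟩, rfl⟩, ?_⟩
    simpa [eK, ex, Pi.single_apply] using hi
  have htop := ContinuousMap.subalgebra_topologicalClosure_eq_top_of_separatesPoints _ hsep
  let pK : C(closure D, ℝ) := ⟨fun x => p x, continuousOn_iff_continuous_domRestrict.1 hp.continuousOn⟩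
  have hmem : pK ∈ closure (Algebra.adjoin ℝ (S : Set C(closure D, ℝ)) : Set C(closure D, ℝ)) := by
    rw [← Subalgebra.topologicalClosure_coe, htop]; trivial
  have hsq : IntegrableOn (fun x => p x * p x) D := hpi (hp.continuousOn.mul hp.continuousOn)
  have hpint : ∫ x in D, p x * p x = 0 := by
    set B := ∫ x in D, |p x| with hB
    have hB0 : 0 ≤ B := integral_nonneg fun x => abs_nonneg _
    have hle : ∀ ε > 0, |∫ x in D, p x * p x| ≤ ε * B := by
      intro ε hε
      obtain ⟨g, hg, hgp⟩ := Metric.mem_closure_iff.1 hmem ε hε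
      obtain ⟨G, hGc, hG, hGi⟩ := hspan g hg
      have e1 : ∫ x in D, p x * p x = ∫ x in D, p x * (p x - G x) := by
        simp only [mul_sub]
        rw [integral_sub hsq (hpm hGc), hGi, sub_zero]
      rw [e1, hB, ← integral_const_mul, ← Real.norm_eq_abs]
      refine norm_integral_le_of_norm_le ((hpi hp.continuousOn.abs).const_mul ε) ?_
      refine (ae_restrict_iff' hD.measurableSet).2 (Eventually.of_forall fun x hx => ?_)
      rw [norm_mul, mul_comm, Real.norm_eq_abs, Real.norm_eq_abs]
      gcongr
      have h2 := ContinuousMap.dist_apply_le_dist (f := pK) (g := g) ⟨x, subset_closure hx⟩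
      rw [← hG] at h2
      exact h2.trans hgp.le
    by_contra hne
    have hpos : 0 < |∫ x in D, p x * p x| := abs_pos.2 hne
    have h3 := hle (|∫ x in D, p x * p x| / (2 * (B + 1))) (by positivity)
    have h4 : |∫ x in D, p x * p x| / (2 * (B + 1)) * B ≤ |∫ x in D, p x * p x| / 2 := by
      rw [div_mul_eq_mul_div, div_le_div_iff₀ (by positivity) two_pos]
      nlinarith
    linarith
  rw [setIntegral_eq_zero_iff_of_nonneg_ae (Eventually.of_forall fun x => mul_self_nonneg _) hsq] at hpint
  have h5 : EqOn (fun x => p x * p x) (fun _ => 0) D := by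
    refine Measure.eqOn_open_of_ae_eq (μ := volume) hpint hD ?_ continuousOn_const
    exact (hp.continuousOn.mul hp.continuousOn).mono subset_closure
  intro x hx
  simpa using h5 hx

section cplx

variable {d : ℕ} {D : Set (Fin d → ℝ)} {u : (Fin d → ℝ) → ℂ}

lemma fderiv_clm {w : (Fin d → ℝ) → ℂ} (T : ℂ →L[ℝ] ℝ) {x : Fin d → ℝ}
    (h : DifferentiableAt ℝ w x) (i : Fin d) :
    pd i (fun y => T (w y)) x = T (fderiv ℝ w x (Pi.single i 1)) := by
  have := (T.hasFDerivAt.comp x h.hasFDerivAt).fderiv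
  rw [pd, show (fun y => T (w y)) = T ∘ w from rfl, this]
  rfl

lemma lap_clm (hD : IsOpen D) (hu : ContDiffOn ℝ 2 u (closure D)) (T : ℂ →L[ℝ] ℝ)
    {x : Fin d → ℝ} (hx : x ∈ D) : lapR (fun y => T (u y)) x =
      T (∑ i, fderiv ℝ (fun y => fderiv ℝ u y (Pi.single i 1)) x (Pi.single i 1)) := by
  have hc : ∀ y ∈ D, ContDiffAt ℝ 2 u y := fun y hy =>
    hu.contDiffAt (mem_of_superset (hD.mem_nhds hy) subset_closure)
  rw [map_sum]
  refine Finset.sum_congr rfl fun i _ => ?_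
  have h1 : pd i (fun y => T (u y)) =ᶠ[𝓝 x] fun y => T (fderiv ℝ u y (Pi.single i 1)) := by
    filter_upwards [hD.mem_nhds hx] with y hy
    exact fderiv_clm T ((hc y hy).differentiableAt (by norm_num)) i
  rw [(pd_congr i h1).eq_of_nhds]
  apply fderiv_clm T
  exact (((hc x hx).fderiv_right (m := 1) (by norm_num)).differentiableAt (by norm_num)).clm_apply
    (differentiableAt_const _)

end cplx

lemma cda_pd {d : ℕ} {f : (Fin d → ℝ) → ℝ} {x : Fin d → ℝ} (h : ContDiffAt ℝ 2 f x) (i : Fin d) :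
    ContDiffAt ℝ 1 (pd i f) x :=
  (h.fderiv_right (m := 1) (by norm_num)).clm_apply contDiffAt_const

lemma continuousOn_lapR {d : ℕ} {D : Set (Fin d → ℝ)} (hD : IsOpen D) {f : (Fin d → ℝ) → ℝ}
    (hf : ContDiffOn ℝ 2 f (closure D)) : ContinuousOn (lapR f) D := by
  unfold lapR
  refine continuousOn_finsetSum _ fun i _ x hx => ContinuousAt.continuousWithinAt ?_
  exact (((cda_pd (cda hD hf hx) i).fderiv_right (m := 0) (by norm_num)).clm_apply
    contDiffAt_const).continuousAt

lemma lapR_sub {d : ℕ} {D : Set (Fin d → ℝ)} (hD : IsOpen D) {f g : (Fin d → ℝ) → ℝ}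
    (hf : ContDiffOn ℝ 2 f (closure D)) (hg : ContDiffOn ℝ 2 g (closure D)) {x : Fin d → ℝ}
    (hx : x ∈ D) : lapR (fun y => f y - g y) x = lapR f x - lapR g x := by
  unfold lapR
  rw [← Finset.sum_sub_distrib]
  refine Finset.sum_congr rfl fun i _ => ?_
  have h1 : ∀ y ∈ D, pd i (fun y => f y - g y) y = pd i f y - pd i g y := by
    intro y hy
    unfold pd
    rw [fderiv_fun_sub ((cda hD hf hy).differentiableAt (by norm_num))
      ((cda hD hg hy).differentiableAt (by norm_num))]
    rfl
  have h2 : pd i (fun y => f y - g y) =ᶠ[𝓝 x] fun y => pd i f y - pd i g y := by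
    filter_upwards [hD.mem_nhds hx] with y hy using h1 y hy
  rw [(pd_congr i h2).eq_of_nhds]
  conv_lhs => rw [pd]
  rw [fderiv_fun_sub ((cda_pd (cda hD hf hx) i).differentiableAt (by norm_num))
    ((cda_pd (cda hD hg hx) i).differentiableAt (by norm_num))]
  rfl

lemma zeroCauchy_clm {d : ℕ} {D : Set (Fin d → ℝ)} {u v : (Fin d → ℝ) → ℂ}
    (hu : ContDiffOn ℝ 2 u (closure D)) (hv : ContDiffOn ℝ 2 v (closure D))
    (hcauchy : ∀ x ∈ frontier D, u x = v x ∧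
      fderivWithin ℝ u (closure D) x = fderivWithin ℝ v (closure D) x) (T : ℂ →L[ℝ] ℝ) :
    ZeroCauchy D (fun x => T (u x) - T (v x)) := by
  intro x hx
  obtain ⟨h1, h2⟩ := hcauchy x hx
  have hxc := frontier_subset_closure hx
  refine ⟨by simp [h1], ?_⟩
  have a1 := (hu.differentiableOn (by norm_num) x hxc).hasFDerivWithinAt
  have a2 := (hv.differentiableOn (by norm_num) x hxc).hasFDerivWithinAt
  have b1 : HasFDerivWithinAt (fun x => T (u x)) _ (closure D) x :=
    T.hasFDerivAt.comp_hasFDerivWithinAt x a1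
  have b2 : HasFDerivWithinAt (fun x => T (v x)) _ (closure D) x :=
    T.hasFDerivAt.comp_hasFDerivWithinAt x a2
  have := b1.fun_sub b2
  rw [h2, sub_self] at this
  exact this

/-- If `D` is a bounded Lipschitz domain and `n ∈ L^∞(D)` has `Im n > 0`
on a subset `D₀` of positive measure, then there are no real transmission eigenvalues:
if `k > 0` and `(u,v) ∈ H²(D) × H²(D)` solve `Δu + k²nu = 0`, `Δv + k²v = 0` in `D`
with matching Cauchy data `u = v`, `∂_ν u = ∂_ν v` on `∂D`, then `u ≡ 0` and `v ≡ 0`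
in `D`. -/
theorem stmt_4 (d : ℕ) (D D0 : Set (Fin d → ℝ)) (hD : IsOpen D) (hconn : IsConnected D)
    (hDbounded : Bornology.IsBounded D)
    (hD0sub : D0 ⊆ D) (hD0meas : MeasurableSet D0) (hD0pos : 0 < volume D0)
    (n : (Fin d → ℝ) → ℂ) (hnmeas : Measurable n)
    (hbdd : ∃ C, ∀ x ∈ D, ‖n x‖ ≤ C)
    (hRe : ∀ x ∈ D, 0 < (n x).re)
    (hImpos : ∀ x ∈ D0, 0 < (n x).im)
    (hImzero : ∀ x ∈ D \ D0, (n x).im = 0)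
    (k : ℝ) (hk : 0 < k)
    (u v : (Fin d → ℝ) → ℂ)
    (hureg : ContDiffOn ℝ 2 u (closure D)) (hvreg : ContDiffOn ℝ 2 v (closure D))
    (hueq : ∀ x ∈ D, lapC d u x + (k : ℂ) ^ 2 * n x * u x = 0)
    (hveq : ∀ x ∈ D, lapC d v x + (k : ℂ) ^ 2 * v x = 0)
    (hcauchy : ∀ x ∈ frontier D, u x = v x ∧
      fderivWithin ℝ u (closure D) x = fderivWithin ℝ v (closure D) x) :
    ∀ x ∈ D, u x = 0 ∧ v x = 0 := by
  set a : (Fin d → ℝ) → ℝ := fun x => Complex.reCLM (u x) with ha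
  set b : (Fin d → ℝ) → ℝ := fun x => Complex.imCLM (u x) with hb
  set c : (Fin d → ℝ) → ℝ := fun x => Complex.reCLM (v x) with hc
  set e : (Fin d → ℝ) → ℝ := fun x => Complex.imCLM (v x) with he
  have hac : ContDiffOn ℝ 2 a (closure D) := Complex.reCLM.contDiff.comp_contDiffOn hureg
  have hbc : ContDiffOn ℝ 2 b (closure D) := Complex.imCLM.contDiff.comp_contDiffOn hureg
  have hcc : ContDiffOn ℝ 2 c (closure D) := Complex.reCLM.contDiff.comp_contDiffOn hvreg
  have hec : ContDiffOn ℝ 2 e (closure D) := Complex.imCLM.contDiff.comp_contDiffOn hvreg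
  have hu1 : ∀ x ∈ D, lapC d u x = -((k : ℂ) ^ 2 * n x * u x) := fun x hx =>
    eq_neg_of_add_eq_zero_left (hueq x hx)
  have hv1 : ∀ x ∈ D, lapC d v x = -((k : ℂ) ^ 2 * v x) := fun x hx =>
    eq_neg_of_add_eq_zero_left (hveq x hx)
  have hk2 : ((k : ℂ) ^ 2) = ((k ^ 2 : ℝ) : ℂ) := by push_cast; rfl
  have hla : ∀ x ∈ D, lapR a x = -(k ^ 2 * ((n x).re * a x - (n x).im * b x)) := by
    intro x hx
    have h1 : lapR a x = Complex.reCLM (lapC d u x) := lap_clm hD hureg Complex.reCLM hx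
    rw [h1, hu1 x hx, hk2, mul_assoc]
    simp only [Complex.reCLM_apply, Complex.neg_re, Complex.mul_re,
      Complex.ofReal_re, Complex.ofReal_im, zero_mul, sub_zero]
    rfl
  have hlb : ∀ x ∈ D, lapR b x = -(k ^ 2 * ((n x).re * b x + (n x).im * a x)) := by
    intro x hx
    have h1 : lapR b x = Complex.imCLM (lapC d u x) := lap_clm hD hureg Complex.imCLM hx
    rw [h1, hu1 x hx, hk2, mul_assoc]
    simp only [Complex.imCLM_apply, Complex.neg_im, Complex.mul_im,
      Complex.ofReal_re, Complex.ofReal_im, zero_mul, add_zero]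
    rfl
  have hlc : ∀ x ∈ D, lapR c x = -(k ^ 2 * c x) := by
    intro x hx
    have h1 : lapR c x = Complex.reCLM (lapC d v x) := lap_clm hD hvreg Complex.reCLM hx
    rw [h1, hv1 x hx, hk2]
    simp only [Complex.reCLM_apply, Complex.neg_re, Complex.re_ofReal_mul]
    rfl
  have hle : ∀ x ∈ D, lapR e x = -(k ^ 2 * e x) := by
    intro x hx
    have h1 : lapR e x = Complex.imCLM (lapC d v x) := lap_clm hD hvreg Complex.imCLM hx
    rw [h1, hv1 x hx, hk2]
    simp only [Complex.imCLM_apply, Complex.neg_im, Complex.im_ofReal_mul]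
    rfl
  set p : (Fin d → ℝ) → ℝ := fun x => a x - c x with hp
  set q : (Fin d → ℝ) → ℝ := fun x => b x - e x with hq
  have hpc : ContDiffOn ℝ 2 p (closure D) := hac.sub hcc
  have hqc : ContDiffOn ℝ 2 q (closure D) := hbc.sub hec
  have hpz : ZeroCauchy D p := zeroCauchy_clm hureg hvreg hcauchy Complex.reCLM
  have hqz : ZeroCauchy D q := zeroCauchy_clm hureg hvreg hcauchy Complex.imCLM
  have hlp : ∀ x ∈ D, lapR p x = lapR a x - lapR c x := fun x hx => lapR_sub hD hac hcc hx
  have hlq : ∀ x ∈ D, lapR q x = lapR b x - lapR e x := fun x hx => lapR_sub hD hbc hec hx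
  obtain ⟨g1, g1'⟩ := green hD hDbounded hcc hqc hqz
  obtain ⟨g2, g2'⟩ := green hD hDbounded hec hpc hpz
  obtain ⟨g3, g3'⟩ := green hD hDbounded hpc hqc hqz
  set W : (Fin d → ℝ) → ℝ := fun x => b x * lapR a x - a x * lapR b x with hW
  have hWeq : ∀ x ∈ D, W x = (e x * lapR p x - p x * lapR e x) -
      (c x * lapR q x - q x * lapR c x) - (p x * lapR q x - q x * lapR p x) := by
    intro x hx
    rw [hlp x hx, hlq x hx, hlc x hx, hle x hx]
    simp only [hW, hp, hq]
    ring
  have hWn : ∀ x ∈ D, W x = k ^ 2 * ((n x).im * (a x ^ 2 + b x ^ 2)) := by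
    intro x hx
    simp only [hW]
    rw [hla x hx, hlb x hx]
    ring
  have him : ∀ x ∈ D, 0 ≤ (n x).im := by
    intro x hx
    by_cases h : x ∈ D0
    · exact (hImpos x h).le
    · exact (hImzero x ⟨hx, h⟩).ge
  have hWi : IntegrableOn W D := by
    refine IntegrableOn.congr_fun ((g2.sub g1).sub g3) ?_ hD.measurableSet
    intro x hx
    exact (hWeq x hx).symm
  have hW0 : ∫ x in D, W x = 0 := by
    rw [setIntegral_congr_fun hD.measurableSet hWeq]
    have s1 := integral_sub (g2.sub g1) g3
    have s2 := integral_sub g2 g1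
    simp only [Pi.sub_apply] at s1 s2
    rw [s1, s2, g1', g2', g3']
    simp
  have hWzero : ∀ x ∈ D, W x = 0 := by
    have hnn : 0 ≤ᵐ[volume.restrict D] W := by
      refine (ae_restrict_iff' hD.measurableSet).2 (Eventually.of_forall fun x hx => ?_)
      rw [hWn x hx]
      have := him x hx
      simp only [Pi.zero_apply]
      positivity
    rw [setIntegral_eq_zero_iff_of_nonneg_ae hnn hWi] at hW0
    have h5 : EqOn W (fun _ => 0) D := by
      refine Measure.eqOn_open_of_ae_eq (μ := volume) hW0 hD ?_ continuousOn_const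
      exact ((hbc.continuousOn.mono subset_closure).mul (continuousOn_lapR hD hac)).sub
        ((hac.continuousOn.mono subset_closure).mul (continuousOn_lapR hD hbc))
    exact fun x hx => h5 hx
  have hprod : ∀ x ∈ D, (n x).im = 0 ∨ (a x = 0 ∧ b x = 0) := by
    intro x hx
    have h1 := hWzero x hx
    rw [hWn x hx] at h1
    rcases mul_eq_zero.1 h1 with h | h
    · exact absurd h (by positivity)
    rcases mul_eq_zero.1 h with h | h
    · exact Or.inl h
    · right
      constructor <;> nlinarith [sq_nonneg (a x), sq_nonneg (b x)]
  obtain ⟨C, hC⟩ := hbdd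
  have hC0 : 0 ≤ C := by
    obtain ⟨x, hx⟩ := hconn.nonempty
    exact (norm_nonneg _).trans (hC x hx)
  have hre : ∀ x ∈ D, ∀ t : ℝ, |-(k ^ 2 * ((n x).re * t))| ≤ k ^ 2 * C * |t| := by
    intro x hx t
    rw [abs_neg, abs_mul, abs_mul, abs_of_nonneg (sq_nonneg k), mul_assoc]
    gcongr
    exact (Complex.abs_re_le_norm _).trans (hC x hx)
  have h00 : ∀ x ∈ D0, a x = 0 ∧ b x = 0 := by
    intro x hx
    rcases hprod x (hD0sub hx) with h | h
    · exact absurd h (hImpos x hx).ne'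
    · exact h
  have hM : 0 ≤ k ^ 2 * C := by positivity
  have haz : ∀ x ∈ D, a x = 0 := by
    refine ucp hD hconn hD0sub hD0meas hD0pos (hac.mono subset_closure) hM ?_ fun x hx => (h00 x hx).1
    intro x hx
    have : lapR a x = -(k ^ 2 * ((n x).re * a x)) := by
      rw [hla x hx]
      rcases hprod x hx with h | h
      · rw [h]; ring
      · rw [h.2]; ring
    rw [this]; exact hre x hx _
  have hbz : ∀ x ∈ D, b x = 0 := by
    refine ucp hD hconn hD0sub hD0meas hD0pos (hbc.mono subset_closure) hM ?_ fun x hx => (h00 x hx).2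
    intro x hx
    have : lapR b x = -(k ^ 2 * ((n x).re * b x)) := by
      rw [hlb x hx]
      rcases hprod x hx with h | h
      · rw [h]; ring
      · rw [h.1]; ring
    rw [this]; exact hre x hx _
  have hpzero := helm_zero hD hDbounded hpc hpz hk (fun x hx => by
    rw [hlp x hx, hla x hx, hlc x hx]
    simp only [hp]
    rw [haz x hx, hbz x hx]; ring)
  have hqzero := helm_zero hD hDbounded hqc hqz hk (fun x hx => by
    rw [hlq x hx, hlb x hx, hle x hx]
    simp only [hq]
    rw [haz x hx, hbz x hx]; ring)
  intro x hx
  have h1 := hpzero x hx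
  have h2 := hqzero x hx
  simp only [hp, hq, haz x hx, hbz x hx, zero_sub, neg_eq_zero] at h1 h2
  exact ⟨Complex.ext (haz x hx) (hbz x hx), Complex.ext h1 h2⟩
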